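/- arXiv:2510.00158 — 10 statements merged into one kernel-verified Lean document; each statement's English description precedes it below -/
import Mathlib

section
/- Let n,m ≥ 1, let ν ∈ P₂(ℝⁿ) and let Y be an ℝᵐ-valued random vector with finite second moment. Let Z ∼ ν be independent of Y, let A₁ ∈ ℝ^{n×n}, A₂ ∈ ℝ^{n×m}, and let π ∈ P₂(ℝⁿ×ℝᵐ) be the law of (X,Y) with X = A₁Z + A₂Y. Assume Σ_YY = Cov(Y) is invertible, and set K = Σ_XY Σ_YY⁻¹, where Σ_XY = Cov(X,Y). Then K = A₂, the kernel y ↦ Law(A₁Z + A₂y) is a version of the conditional distribution of X given Y, and for every y⋆ ∈ ℝᵐ the Ensemble Kalman Update L^{EnKU}_{π,y⋆}(x,y) = x + K(y⋆ − y) pushes π forward to Law(A₁Z + A₂y⋆); in particular the Ensemble Kalman Update is an exact affine conditioning map for π. -/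
open MeasureTheory ProbabilityTheory Matrix
open scoped ENNReal

/-- The (cross-)covariance matrix of two random vectors `X : Ω → ℝⁿ`, `Y : Ω → ℝᵐ`:
`(covMat μ X Y) i j = E[(Xᵢ − E Xᵢ)(Yⱼ − E Yⱼ)]`. -/
noncomputable def covMat {Ω : Type*} [MeasurableSpace Ω] (μ : Measure Ω) {n m : ℕ}
    (X : Ω → Fin n → ℝ) (Y : Ω → Fin m → ℝ) : Matrix (Fin n) (Fin m) ℝ :=
  Matrix.of fun i j =>
    ∫ ω, (X ω i - ∫ ω', X ω' i ∂μ) * (Y ω j - ∫ ω', Y ω' j ∂μ) ∂μ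

/-- `κ` is a version of the conditional distribution of `X` given `Y` (a Markov kernel
`y ↦ κ y` disintegrating the joint law over the law of `Y`). -/
def IsCondDistrib {Ω : Type*} [MeasurableSpace Ω] (μ : Measure Ω) {n m : ℕ}
    (X : Ω → Fin n → ℝ) (Y : Ω → Fin m → ℝ)
    (κ : (Fin m → ℝ) → Measure (Fin n → ℝ)) : Prop :=
  (∀ B : Set (Fin n → ℝ), MeasurableSet B → Measurable fun y => κ y B) ∧
  (∀ y, IsProbabilityMeasure (κ y)) ∧
  ∀ B : Set (Fin n → ℝ), MeasurableSet B → ∀ A : Set (Fin m → ℝ), MeasurableSet A →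
    μ {ω | X ω ∈ B ∧ Y ω ∈ A} = ∫⁻ y in A, κ y B ∂(μ.map Y)

lemma covMat_apply {Ω : Type*} [MeasurableSpace Ω] (μ : Measure Ω) {n m : ℕ}
    (X : Ω → Fin n → ℝ) (Y : Ω → Fin m → ℝ) (i : Fin n) (j : Fin m) :
    covMat μ X Y i j = cov[fun ω => X ω i, fun ω => Y ω j; μ] := rfl

lemma memLp_two_apply_of_integrable_sq_norm {Ω : Type*} [MeasurableSpace Ω] {μ : Measure Ω}
    {n : ℕ} {X : Ω → Fin n → ℝ} (hX : AEStronglyMeasurable X μ)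
    (hX2 : Integrable (fun ω => ‖X ω‖ ^ 2) μ) (i : Fin n) :
    MemLp (fun ω => X ω i) 2 μ :=
  ((memLp_two_iff_integrable_sq_norm hX).2 hX2).eval i

lemma memLp_two_mulVec_apply {Ω : Type*} [MeasurableSpace Ω] {μ : Measure Ω} {n k : ℕ}
    (A : Matrix (Fin k) (Fin n) ℝ) {X : Ω → Fin n → ℝ} (hX : ∀ i, MemLp (fun ω => X ω i) 2 μ)
    (i : Fin k) : MemLp (fun ω => A.mulVec (X ω) i) 2 μ := by
  simp only [Matrix.mulVec, dotProduct]
  exact memLp_finsetSum _ fun l _ => (hX l).const_mul (A i l)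

lemma covMat_mulVec_left {Ω : Type*} [MeasurableSpace Ω] {μ : Measure Ω} [IsFiniteMeasure μ]
    {n m k : ℕ} (A : Matrix (Fin k) (Fin n) ℝ) {X : Ω → Fin n → ℝ} {Y : Ω → Fin m → ℝ}
    (hX : ∀ i, MemLp (fun ω => X ω i) 2 μ) (hY : ∀ j, MemLp (fun ω => Y ω j) 2 μ) :
    covMat μ (fun ω => A.mulVec (X ω)) Y = A * covMat μ X Y := by
  ext i j
  simp only [covMat_apply, Matrix.mul_apply, Matrix.mulVec, dotProduct]
  rw [covariance_fun_sum_left (fun l => (hX l).const_mul (A i l)) (hY j)]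
  simp only [covariance_const_mul_left]

lemma covMat_add_left {Ω : Type*} [MeasurableSpace Ω] {μ : Measure Ω} [IsFiniteMeasure μ]
    {n m : ℕ} {X X' : Ω → Fin n → ℝ} {Y : Ω → Fin m → ℝ}
    (hX : ∀ i, MemLp (fun ω => X ω i) 2 μ) (hX' : ∀ i, MemLp (fun ω => X' ω i) 2 μ)
    (hY : ∀ j, MemLp (fun ω => Y ω j) 2 μ) :
    covMat μ (fun ω => X ω + X' ω) Y = covMat μ X Y + covMat μ X' Y := by
  ext i j
  exact covariance_add_left (hX i) (hX' i) (hY j)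

lemma covMat_eq_zero_of_indepFun {Ω : Type*} [MeasurableSpace Ω] {μ : Measure Ω}
    {n m : ℕ} {X : Ω → Fin n → ℝ} {Y : Ω → Fin m → ℝ} (h : IndepFun X Y μ)
    (hX : ∀ i, MemLp (fun ω => X ω i) 2 μ) (hY : ∀ j, MemLp (fun ω => Y ω j) 2 μ) :
    covMat μ X Y = 0 := by
  ext i j
  exact (h.comp (measurable_pi_apply i) (measurable_pi_apply j)).covariance_eq_zero (hX i) (hY j)

/-- If `X = f (Z, Y)` with `Z` independent of `Y`, then `y ↦ Law(f (Z, y))` is a version of the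
conditional distribution of `X` given `Y`. -/
lemma isCondDistrib_of_indepFun {Ω E : Type*} [MeasurableSpace Ω] [MeasurableSpace E]
    {μ : Measure Ω} [IsProbabilityMeasure μ] {n m : ℕ} {Z : Ω → E} {Y : Ω → Fin m → ℝ}
    (hZ : Measurable Z) (hY : Measurable Y) (hindep : IndepFun Z Y μ)
    {f : E × (Fin m → ℝ) → Fin n → ℝ} (hf : Measurable f) :
    IsCondDistrib μ (fun ω => f (Z ω, Y ω)) Y (fun y => μ.map fun ω => f (Z ω, y)) := by
  have hsec (y : Fin m → ℝ) : Measurable fun ω => f (Z ω, y) := by fun_prop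
  have hmap (y : Fin m → ℝ) {B : Set (Fin n → ℝ)} (hB : MeasurableSet B) :
      μ.map (fun ω => f (Z ω, y)) B = μ.map Z ((fun z => (z, y)) ⁻¹' (f ⁻¹' B)) := by
    rw [Measure.map_apply (hsec y) hB,
      Measure.map_apply hZ (measurable_prodMk_right (hf hB))]
    rfl
  have := Measure.isProbabilityMeasure_map (μ := μ) hZ.aemeasurable
  have := Measure.isProbabilityMeasure_map (μ := μ) hY.aemeasurable
  refine ⟨fun B hB => ?_, fun y => Measure.isProbabilityMeasure_map (hsec y).aemeasurable,
    fun B hB A hA => ?_⟩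
  · simp only [hmap _ hB]
    exact measurable_measure_prodMk_right (hf hB)
  · have hS : MeasurableSet (f ⁻¹' B ∩ Prod.snd ⁻¹' A) := (hf hB).inter (measurable_snd hA)
    calc μ {ω | f (Z ω, Y ω) ∈ B ∧ Y ω ∈ A}
        = μ.map (fun ω => (Z ω, Y ω)) (f ⁻¹' B ∩ Prod.snd ⁻¹' A) := by
          rw [Measure.map_apply (hZ.prodMk hY) hS]
          rfl
      _ = ∫⁻ y, μ.map Z ((fun z => (z, y)) ⁻¹' (f ⁻¹' B ∩ Prod.snd ⁻¹' A)) ∂(μ.map Y) := by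
          rw [(indepFun_iff_map_prod_eq_prod_map_map hZ.aemeasurable hY.aemeasurable).1 hindep,
            Measure.prod_apply_symm hS]
      _ = ∫⁻ y in A, μ.map (fun ω => f (Z ω, y)) B ∂(μ.map Y) := by
          rw [← lintegral_indicator hA]
          refine lintegral_congr fun y => ?_
          by_cases hy : y ∈ A <;> simp [hy, hmap y hB, ← Set.preimage_comp, Function.comp_def]


/-- Let `Z ∼ ν` (on `ℝⁿ`) be independent of `Y` (on `ℝᵐ`), both with
finite second moments, let `X = A₁ Z + A₂ Y`, and let `π` be the law of `(X, Y)`.  Assume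
`Σ_YY = Cov(Y)` is invertible and set `K = Σ_XY Σ_YY⁻¹`.  Then `K = A₂`, the kernel
`y ↦ Law(A₁ Z + A₂ y)` is a version of the conditional distribution of `X` given `Y`, and
for every `y⋆` the Ensemble Kalman Update `(x,y) ↦ x + K(y⋆ − y)` pushes `π` forward to
`Law(A₁ Z + A₂ y⋆)`; in particular the EnKU is an exact affine conditioning map for `π`. -/
theorem enku_exact_for_linear_coupling {n m : ℕ} (hn : 1 ≤ n) (hm : 1 ≤ m)
    {Ω : Type*} [MeasurableSpace Ω] (μ : Measure Ω) [IsProbabilityMeasure μ]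
    (Z : Ω → Fin n → ℝ) (Y : Ω → Fin m → ℝ) (hZ : Measurable Z) (hY : Measurable Y)
    (hZ2 : Integrable (fun ω => ‖Z ω‖ ^ 2) μ) (hY2 : Integrable (fun ω => ‖Y ω‖ ^ 2) μ)
    (hindep : IndepFun Z Y μ)
    (A₁ : Matrix (Fin n) (Fin n) ℝ) (A₂ : Matrix (Fin n) (Fin m) ℝ)
    (X : Ω → Fin n → ℝ) (hXdef : X = fun ω => A₁.mulVec (Z ω) + A₂.mulVec (Y ω))
    (π : Measure ((Fin n → ℝ) × (Fin m → ℝ)))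
    (hπ : π = μ.map (fun ω => (X ω, Y ω)))
    (hYY : IsUnit (covMat μ Y Y))
    (K : Matrix (Fin n) (Fin m) ℝ) (hK : K = covMat μ X Y * (covMat μ Y Y)⁻¹) :
    K = A₂ ∧
    IsCondDistrib μ X Y (fun y => μ.map (fun ω => A₁.mulVec (Z ω) + A₂.mulVec y)) ∧
    ∀ ystar : Fin m → ℝ,
      π.map (fun p => p.1 + K.mulVec (ystar - p.2)) =
        μ.map (fun ω => A₁.mulVec (Z ω) + A₂.mulVec ystar) := by
  have hZL := memLp_two_apply_of_integrable_sq_norm hZ.aestronglyMeasurable hZ2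
  have hYL := memLp_two_apply_of_integrable_sq_norm hY.aestronglyMeasurable hY2
  have hXY : covMat μ X Y = A₂ * covMat μ Y Y := by
    rw [hXdef, covMat_add_left (memLp_two_mulVec_apply A₁ hZL) (memLp_two_mulVec_apply A₂ hYL) hYL,
      covMat_mulVec_left A₁ hZL hYL, covMat_mulVec_left A₂ hYL hYL,
      covMat_eq_zero_of_indepFun hindep hZL hYL, Matrix.mul_zero, zero_add]
  have hKA : K = A₂ := by
    rw [hK, hXY, Matrix.mul_nonsing_inv_cancel_right _ _ ((Matrix.isUnit_iff_isUnit_det _).1 hYY)]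
  have hA₁ : Measurable A₁.mulVec :=
    (Continuous.matrix_mulVec continuous_const continuous_id).measurable
  have hA₂ : Measurable A₂.mulVec :=
    (Continuous.matrix_mulVec continuous_const continuous_id).measurable
  refine ⟨hKA, ?_, fun ystar => ?_⟩
  · rw [hXdef]
    exact isCondDistrib_of_indepFun (f := fun p => A₁.mulVec p.1 + A₂.mulVec p.2) hZ hY hindep
      (by fun_prop)
  · rw [hπ, hKA, Measure.map_map (by fun_prop) (by rw [hXdef]; fun_prop), hXdef]
    congr 1
    ext1 ω
    simp only [Function.comp_apply, Matrix.mulVec_sub]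
    abel
end

section
/- Let n,m ≥ 1 and let π ∈ P₂(ℝⁿ×ℝᵐ) be the law of (X,Y). Assume Σ_YY = Cov(Y) is invertible and set K = Σ_XY Σ_YY⁻¹ with Σ_XY = Cov(X,Y). If for π_Y-almost every y⋆ ∈ ℝᵐ the pushforward of π under the Ensemble Kalman Update L^{EnKU}_{π,y⋆}(x,y) = x + K(y⋆ − y) equals (a version of) the conditional distribution π_{X|Y=y⋆}, then the random vector Z := X − KY is independent of Y, and π_{X|Y=y⋆} = Law(Z + Ky⋆) for π_Y-almost every y⋆; in particular there exist ν ∈ P₂(ℝⁿ) (namely ν = Law(Z)) and a linear map O : ℝⁿ×ℝᵐ → ℝⁿ (namely O(x,y) = x + Ky) such that π_{X|Y=y} = O(·,y)_♯ν for π_Y-almost every y. -/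
open MeasureTheory ProbabilityTheory Matrix
open scoped ENNReal

/-- If the conditional distribution of `X` given `Y = y` is the law of `X - g Y`, translated by
`g y`, then `X - g Y` is independent of `Y`. -/
theorem IsCondDistrib.indepFun_sub {Ω : Type*} [MeasurableSpace Ω] {μ : Measure Ω}
    [IsProbabilityMeasure μ] {n m : ℕ} {X : Ω → Fin n → ℝ} {Y : Ω → Fin m → ℝ}
    {κ : (Fin m → ℝ) → Measure (Fin n → ℝ)} (hκ : IsCondDistrib μ X Y κ)
    (hX : Measurable X) (hY : Measurable Y)
    {g : (Fin m → ℝ) → Fin n → ℝ} (hg : Measurable g)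
    (h : ∀ᵐ y ∂(μ.map Y), κ y = μ.map (fun ω => (X ω - g (Y ω)) + g y)) :
    IndepFun (fun ω => X ω - g (Y ω)) Y μ := by
  have hZ : Measurable fun ω => X ω - g (Y ω) := hX.sub (hg.comp hY)
  have := Measure.isProbabilityMeasure_map (μ := μ) hZ.aemeasurable
  have := Measure.isProbabilityMeasure_map (μ := μ) hY.aemeasurable
  have hXY : Measurable fun ω => (X ω, Y ω) := hX.prodMk hY
  have hshear : Measurable fun q : (Fin n → ℝ) × (Fin m → ℝ) => (q.1 + g q.2, q.2) := by
    fun_prop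
  have hunshear : Measurable fun q : (Fin n → ℝ) × (Fin m → ℝ) => (q.1 - g q.2, q.2) := by
    fun_prop
  have hjoint : μ.map (fun ω => (X ω, Y ω)) =
      ((μ.map fun ω => X ω - g (Y ω)).prod (μ.map Y)).map
        (fun q => (q.1 + g q.2, q.2)) := by
    have := Measure.isProbabilityMeasure_map (μ := μ) hXY.aemeasurable
    refine Measure.ext_prod fun {B A} hB hA => ?_
    rw [Measure.map_apply hXY (hB.prod hA), Measure.map_apply hshear (hB.prod hA),
      Measure.prod_apply_symm (hshear (hB.prod hA))]
    refine (hκ.2.2 B hB A hA).trans ?_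
    rw [← lintegral_indicator hA]
    refine lintegral_congr_ae ?_
    filter_upwards [h] with y hy
    rw [Measure.map_apply hZ (measurable_prodMk_right (hshear (hB.prod hA)))]
    by_cases hyA : y ∈ A
    · rw [Set.indicator_of_mem hyA, hy, Measure.map_apply (hZ.add_const _) hB]
      congr 1
      ext ω
      simp [hyA]
    · simp [hyA, Set.preimage]
  rw [indepFun_iff_map_prod_eq_prod_map_map hZ.aemeasurable hY.aemeasurable]
  have hmap := congrArg (Measure.map fun q => (q.1 - g q.2, q.2)) hjoint
  rw [Measure.map_map hunshear hXY, Measure.map_map hunshear hshear] at hmap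
  simpa [Function.comp_def] using hmap

/-- Let `π` be the law of `(X,Y)` with `Σ_YY = Cov(Y)` invertible and
`K = Σ_XY Σ_YY⁻¹`.  If, for `π_Y`-a.e. `y⋆`, the pushforward of `π` under the Ensemble
Kalman Update `(x,y) ↦ x + K(y⋆ − y)` equals a version `κ y⋆` of the conditional
distribution of `X` given `Y`, then `Z = X − KY` is independent of `Y` and
`κ y⋆ = Law(Z + K y⋆)` for `π_Y`-a.e. `y⋆`; in particular `π_{X|Y=y} = O(·,y)_♯ ν` with
`ν = Law(Z)` and the linear map `O(x,y) = x + K y`. -/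
theorem enku_exactness_forces_linear_structure {n m : ℕ} (hn : 1 ≤ n) (hm : 1 ≤ m)
    {Ω : Type*} [MeasurableSpace Ω] (μ : Measure Ω) [IsProbabilityMeasure μ]
    (X : Ω → Fin n → ℝ) (Y : Ω → Fin m → ℝ) (hX : Measurable X) (hY : Measurable Y)
    (hX2 : Integrable (fun ω => ‖X ω‖ ^ 2) μ) (hY2 : Integrable (fun ω => ‖Y ω‖ ^ 2) μ)
    (π : Measure ((Fin n → ℝ) × (Fin m → ℝ)))
    (hπ : π = μ.map (fun ω => (X ω, Y ω)))
    (hYY : IsUnit (covMat μ Y Y))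
    (K : Matrix (Fin n) (Fin m) ℝ) (hK : K = covMat μ X Y * (covMat μ Y Y)⁻¹)
    (κ : (Fin m → ℝ) → Measure (Fin n → ℝ)) (hκ : IsCondDistrib μ X Y κ)
    (hexact : ∀ᵐ ystar ∂(μ.map Y),
      π.map (fun p => p.1 + K.mulVec (ystar - p.2)) = κ ystar) :
    IndepFun (fun ω => X ω - K.mulVec (Y ω)) Y μ ∧
    ∀ᵐ ystar ∂(μ.map Y),
      κ ystar = μ.map (fun ω => (X ω - K.mulVec (Y ω)) + K.mulVec ystar) := by
  have hK_meas : Measurable K.mulVec :=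
    (continuous_const.matrix_mulVec continuous_id).measurable
  have hcond : ∀ᵐ ystar ∂(μ.map Y),
      κ ystar = μ.map (fun ω => (X ω - K.mulVec (Y ω)) + K.mulVec ystar) := by
    filter_upwards [hexact] with ystar hy
    rw [← hy, hπ, Measure.map_map (by fun_prop) (hX.prodMk hY)]
    congr 1
    ext1 ω
    simp only [Function.comp_apply, Matrix.mulVec_sub]
    abel
  exact ⟨hκ.indepFun_sub hX hY hK_meas hcond, hcond⟩
end

section
/- Let n,m ≥ 1, let Y be an ℝᵐ-valued random vector and Z an ℝⁿ-valued random vector independent of Y, both with finite second moments, let M ∈ ℝ^{n×m}, set X = Z + MY, and let π be the law of (X,Y). Fix y⋆ ∈ ℝᵐ and suppose the affine map ℓ(x,y) = Ax + By + c (A ∈ ℝ^{n×n}, B ∈ ℝ^{n×m}, c ∈ ℝⁿ) satisfies ℓ_♯π = Law(Z + My⋆). If Cov(Z) is nonsingular, then every complex eigenvalue of A has modulus at most 1, and for every complex eigenvalue λ of A with |λ| = 1 the generalized eigenspace of the complexification of A for λ coincides with the eigenspace ker(A − λI) (i.e., A is diagonalizable on the sum of generalized eigenspaces of unit-modulus eigenvalues).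 -/
open MeasureTheory ProbabilityTheory Matrix Module

theorem pow_apply_of_generalized {E : Type*} [AddCommGroup E] [Module ℂ E] (f : End ℂ E) (l : ℂ)
    (v w : E) (hv : f v = l • v + w) (hw : f w = l • w) (k : ℕ) :
    l • (f ^ k) v = l ^ (k + 1) • v + ((k : ℂ) * l ^ k) • w := by
  induction k with
  | zero => simp
  | succ k ih =>
    rw [pow_succ', Module.End.mul_apply, ← map_smul, ih, map_add, map_smul, map_smul, hv, hw]
    push_cast
    module

theorem norm_le_one_of_power_bounded {E : Type*} [NormedAddCommGroup E] [NormedSpace ℂ E]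
    (f : End ℂ E) (hf : ∀ v, ∃ D : ℝ, ∀ k, ‖(f ^ k) v‖ ≤ D) {l : ℂ} (hl : f.HasEigenvalue l) :
    ‖l‖ ≤ 1 := by
  obtain ⟨v, hv⟩ := hl.exists_hasEigenvector
  obtain ⟨D, hD⟩ := hf v
  by_contra! h
  obtain ⟨k, hk⟩ := pow_unbounded_of_one_lt (D / ‖v‖) h
  have := hD k
  rw [hv.pow_apply, norm_smul, norm_pow] at this
  rw [div_lt_iff₀ (norm_pos_iff.2 hv.2)] at hk
  linarith

theorem maxGenEigenspace_eq_eigenspace_of_power_bounded {E : Type*} [NormedAddCommGroup E]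
    [NormedSpace ℂ E] (f : End ℂ E) (hf : ∀ v, ∃ D : ℝ, ∀ k, ‖(f ^ k) v‖ ≤ D) {l : ℂ}
    (hl : ‖l‖ = 1) : f.maxGenEigenspace l = f.eigenspace l := by
  have key : ∀ v, (f - l • 1) ((f - l • 1) v) = 0 → (f - l • 1) v = 0 := by
    intro v hv
    set w := (f - l • 1) v with hw
    have hfv : f v = l • v + w := by simp [hw]
    have hfw : f w = l • w := by simpa [sub_eq_zero] using hv
    obtain ⟨D, hD⟩ := hf v
    by_contra hne
    obtain ⟨k, hk⟩ := exists_nat_gt ((D + ‖v‖) / ‖w‖)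
    rw [div_lt_iff₀ (norm_pos_iff.2 hne)] at hk
    have h1 : ((k : ℂ) * l ^ k) • w = l • (f ^ k) v - l ^ (k + 1) • v := by
      rw [pow_apply_of_generalized f l v w hfv hfw]; abel
    have h2 := congrArg norm h1
    have h3 := norm_sub_le (l • (f ^ k) v) (l ^ (k + 1) • v)
    simp only [norm_smul, norm_mul, norm_pow, hl, one_pow, one_mul, mul_one,
      Complex.norm_natCast] at h2 h3
    linarith [hD k]
  have iter : ∀ (k : ℕ) (v : E), ((f - l • 1) ^ k) v = 0 → (f - l • 1) v = 0 := by
    intro k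
    induction k with
    | zero => intro v hv; simp_all
    | succ k ih =>
      intro v hv
      refine key v (ih _ ?_)
      rwa [pow_succ, Module.End.mul_apply] at hv
  ext v
  rw [Module.End.mem_maxGenEigenspace, Module.End.mem_eigenspace_iff]
  constructor
  · rintro ⟨k, hk⟩
    simpa [sub_eq_zero] using iter k v hk
  · intro h
    exact ⟨1, by simp [h]⟩

open scoped MatrixOrder in
theorem exists_conjTranspose_mul_self_of_posSemidef_of_isUnit {n : Type*} [Fintype n]
    [DecidableEq n] {S : Matrix n n ℝ} (hS : S.PosSemidef) (hu : IsUnit S) :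
    ∃ R : Matrix n n ℝ, IsUnit R ∧ S = Rᵀ * R := by
  obtain ⟨R, rfl⟩ := CStarAlgebra.nonneg_iff_eq_star_mul_self.mp hS.nonneg
  refine ⟨R, ?_, by simp [star_eq_conjTranspose]⟩
  rw [Matrix.isUnit_iff_isUnit_det] at hu ⊢
  rw [Matrix.det_mul] at hu
  exact isUnit_of_mul_isUnit_right hu

/-- A matrix which is nonincreasing for a nondegenerate positive semidefinite quadratic form has
bounded powers. -/
theorem exists_abs_pow_apply_le {n : Type*} [Fintype n] [DecidableEq n] {S N : Matrix n n ℝ}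
    (hS : S.PosSemidef) (hu : IsUnit S)
    (hN : ∀ u, (N *ᵥ u) ⬝ᵥ S *ᵥ (N *ᵥ u) ≤ u ⬝ᵥ S *ᵥ u) :
    ∃ C : ℝ, ∀ k i j, |(N ^ k) i j| ≤ C := by
  obtain ⟨R, hR, rfl⟩ := exists_conjTranspose_mul_self_of_posSemidef_of_isUnit hS hu
  have hq : ∀ u, u ⬝ᵥ (Rᵀ * R) *ᵥ u = ∑ i, (R *ᵥ u) i ^ 2 := by
    intro u
    rw [← Matrix.mulVec_mulVec, Matrix.dotProduct_mulVec, Matrix.vecMul_transpose]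
    simp [dotProduct, sq]
  simp only [hq] at hN
  have hpow : ∀ k u, ∑ i, (R *ᵥ (N ^ k *ᵥ u)) i ^ 2 ≤ ∑ i, (R *ᵥ u) i ^ 2 := by
    intro k u
    induction k with
    | zero => simp
    | succ k ih =>
      rw [pow_succ', ← Matrix.mulVec_mulVec]
      exact (hN _).trans ih
  have hent : ∀ k i j, |(R * N ^ k) i j| ≤ √(∑ i, ∑ j, R i j ^ 2) := by
    intro k i j
    refine Real.abs_le_sqrt ?_
    have h := hpow k (Pi.single j 1)
    rw [Matrix.mulVec_mulVec] at h
    simp only [Matrix.mulVec_single_one, Matrix.col_apply] at h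
    calc _ ≤ ∑ i, (R * N ^ k) i j ^ 2 :=
          Finset.single_le_sum (f := fun i => (R * N ^ k) i j ^ 2)
            (fun i _ => sq_nonneg _) (Finset.mem_univ i)
      _ ≤ _ := h.trans (Finset.sum_le_sum fun i _ =>
          Finset.single_le_sum (f := fun j => R i j ^ 2)
            (fun j _ => sq_nonneg _) (Finset.mem_univ j))
  refine ⟨∑ i, ∑ j, |R⁻¹ i j| * √(∑ i, ∑ j, R i j ^ 2), fun k i j => ?_⟩
  have hNk : N ^ k = R⁻¹ * (R * N ^ k) := by
    rw [← Matrix.mul_assoc, Matrix.nonsing_inv_mul _ ((Matrix.isUnit_iff_isUnit_det _).1 hR),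
      Matrix.one_mul]
  rw [hNk, Matrix.mul_apply]
  calc _ ≤ ∑ l, |R⁻¹ i l * (R * N ^ k) l j| := Finset.abs_sum_le_sum_abs _ _
    _ ≤ ∑ l, |R⁻¹ i l| * √(∑ i, ∑ j, R i j ^ 2) := by
        refine Finset.sum_le_sum fun l _ => ?_
        rw [abs_mul]
        exact mul_le_mul_of_nonneg_left (hent k l j) (abs_nonneg _)
    _ ≤ _ := Finset.single_le_sum
        (f := fun i => ∑ l, |R⁻¹ i l| * √(∑ i, ∑ j, R i j ^ 2))
        (fun i _ => by positivity) (Finset.mem_univ i)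

theorem toLin'_ofReal_power_bounded {n : Type*} [Fintype n] [DecidableEq n] {A : Matrix n n ℝ}
    {C : ℝ} (hC : ∀ k i j, |(A ^ k) i j| ≤ C) (v : n → ℂ) :
    ∃ D : ℝ, ∀ k, ‖(Matrix.toLin' (A.map Complex.ofReal) ^ k) v‖ ≤ D := by
  refine ⟨∑ j, |C| * ‖v j‖, fun k => ?_⟩
  have hmap : A.map Complex.ofReal ^ k = (A ^ k).map Complex.ofReal :=
    (Matrix.map_pow A Complex.ofRealHom k).symm
  rw [← Matrix.toLin'_pow, hmap, Matrix.toLin'_apply, pi_norm_le_iff_of_nonneg (by positivity)]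
  intro i
  refine (norm_sum_le _ _).trans (Finset.sum_le_sum fun j _ => ?_)
  rw [norm_mul]
  refine mul_le_mul_of_nonneg_right ?_ (norm_nonneg _)
  simpa using (hC k i j).trans (le_abs_self C)

theorem memLp_dotProduct {Ω : Type*} [MeasurableSpace Ω] {μ : Measure Ω} {ι : Type*} [Fintype ι]
    {Z : Ω → ι → ℝ} (hZ : MemLp Z 2 μ) (u : ι → ℝ) : MemLp (fun ω => u ⬝ᵥ Z ω) 2 μ :=
  memLp_finsetSum _ fun i _ => (hZ.eval i).const_mul (u i)

theorem variance_dotProduct {Ω : Type*} [MeasurableSpace Ω] {μ : Measure Ω}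
    [IsProbabilityMeasure μ] {n : ℕ} {Z : Ω → Fin n → ℝ} (hZ : MemLp Z 2 μ) (u : Fin n → ℝ) :
    Var[fun ω => u ⬝ᵥ Z ω; μ] = u ⬝ᵥ covMat μ Z Z *ᵥ u := by
  rw [← covariance_self (memLp_dotProduct hZ u).aemeasurable]
  simp only [dotProduct]
  rw [covariance_fun_sum_fun_sum (fun i => (hZ.eval i).const_mul _)
    (fun i => (hZ.eval i).const_mul _)]
  simp only [covariance_const_mul_left, covariance_const_mul_right, Matrix.mulVec, dotProduct,
    Finset.mul_sum]
  refine Finset.sum_congr rfl fun i _ => Finset.sum_congr rfl fun j _ => ?_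
  simp only [covMat, covariance, Matrix.of_apply]
  ring

theorem posSemidef_covMat {Ω : Type*} [MeasurableSpace Ω] {μ : Measure Ω}
    [IsProbabilityMeasure μ] {n : ℕ} {Z : Ω → Fin n → ℝ} (hZ : MemLp Z 2 μ) :
    (covMat μ Z Z).PosSemidef := by
  refine .of_dotProduct_mulVec_nonneg ?_ fun u => ?_
  · ext i j
    simp [covMat, mul_comm]
  · rw [star_trivial, ← variance_dotProduct hZ]
    exact variance_nonneg _ _

/-- If `AX + BY + c` has the law of a translate of `Z`, where `X = Z + MY` with `Z` and `Y`
independent, then `Aᵀ` is nonincreasing for the covariance form of `Z`. -/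
theorem covMat_transpose_mulVec_le {n m : ℕ} {Ω : Type*} [MeasurableSpace Ω] {μ : Measure Ω}
    [IsProbabilityMeasure μ] {Z : Ω → Fin n → ℝ} {Y : Ω → Fin m → ℝ} (hZ : MemLp Z 2 μ)
    (hY : MemLp Y 2 μ) (hindep : IndepFun Z Y μ) (M : Matrix (Fin n) (Fin m) ℝ)
    (A : Matrix (Fin n) (Fin n) ℝ) (B : Matrix (Fin n) (Fin m) ℝ) (c z : Fin n → ℝ)
    (hid : IdentDistrib (fun ω => A *ᵥ (Z ω + M *ᵥ Y ω) + B *ᵥ Y ω + c) (fun ω => Z ω + z) μ μ)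
    (u : Fin n → ℝ) :
    (Aᵀ *ᵥ u) ⬝ᵥ covMat μ Z Z *ᵥ (Aᵀ *ᵥ u) ≤ u ⬝ᵥ covMat μ Z Z *ᵥ u := by
  have hu : Measurable fun x : Fin n → ℝ => u ⬝ᵥ x := by
    unfold dotProduct; fun_prop
  have h := (hid.comp hu).variance_eq
  set w := (A * M + B)ᵀ *ᵥ u
  have h1 : (fun x : Fin n → ℝ => u ⬝ᵥ x) ∘ (fun ω => A *ᵥ (Z ω + M *ᵥ Y ω) + B *ᵥ Y ω + c) =
      fun ω => ((fun ω => (Aᵀ *ᵥ u) ⬝ᵥ Z ω) + fun ω => w ⬝ᵥ Y ω) ω + u ⬝ᵥ c := by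
    ext ω
    simp only [w, Function.comp_apply, Pi.add_apply, Matrix.mulVec_transpose,
      ← Matrix.dotProduct_mulVec, Matrix.mulVec_add, Matrix.add_mulVec, Matrix.mulVec_mulVec,
      dotProduct_add]
    ring
  have h2 : (fun x : Fin n → ℝ => u ⬝ᵥ x) ∘ (fun ω => Z ω + z) =
      fun ω => (fun ω => u ⬝ᵥ Z ω) ω + u ⬝ᵥ z := by
    ext ω
    simp [dotProduct_add]
  have hZA := memLp_dotProduct hZ (Aᵀ *ᵥ u)
  have hYw := memLp_dotProduct hY w
  have hind : IndepFun (fun ω => (Aᵀ *ᵥ u) ⬝ᵥ Z ω) (fun ω => w ⬝ᵥ Y ω) μ :=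
    hindep.comp (φ := fun x => (Aᵀ *ᵥ u) ⬝ᵥ x) (ψ := fun y => w ⬝ᵥ y)
      (by unfold dotProduct; fun_prop) (by unfold dotProduct; fun_prop)
  rw [h1, h2, variance_add_const (hZA.add hYw).aestronglyMeasurable,
    variance_add_const (memLp_dotProduct hZ u).aestronglyMeasurable,
    hind.variance_add hZA hYw, variance_dotProduct hZ, variance_dotProduct hZ] at h
  linarith [variance_nonneg (fun ω => w ⬝ᵥ Y ω) μ]

/-- Let `X = Z + MY` with `Z` independent of `Y` (finite second moments),
and let `π` be the law of `(X,Y)`.  Suppose the affine map `ℓ(x,y) = Ax + By + c` pushes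
`π` forward to `Law(Z + M y⋆)`.  If `Cov(Z)` is nonsingular, then every complex eigenvalue
of `A` has modulus at most `1` and, for each eigenvalue of modulus `1`, the generalized
eigenspace of the complexification of `A` equals the eigenspace (i.e. `A` is diagonalizable
on the unit-modulus part of the spectrum). -/
theorem exact_affine_map_spectral_constraints {n m : ℕ} (hn : 1 ≤ n) (hm : 1 ≤ m)
    {Ω : Type*} [MeasurableSpace Ω] (μ : Measure Ω) [IsProbabilityMeasure μ]
    (Z : Ω → Fin n → ℝ) (Y : Ω → Fin m → ℝ) (hZ : Measurable Z) (hY : Measurable Y)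
    (hZ2 : Integrable (fun ω => ‖Z ω‖ ^ 2) μ) (hY2 : Integrable (fun ω => ‖Y ω‖ ^ 2) μ)
    (hindep : IndepFun Z Y μ)
    (M : Matrix (Fin n) (Fin m) ℝ)
    (X : Ω → Fin n → ℝ) (hXdef : X = fun ω => Z ω + M.mulVec (Y ω))
    (π : Measure ((Fin n → ℝ) × (Fin m → ℝ)))
    (hπ : π = μ.map (fun ω => (X ω, Y ω)))
    (ystar : Fin m → ℝ)
    (A : Matrix (Fin n) (Fin n) ℝ) (B : Matrix (Fin n) (Fin m) ℝ) (c : Fin n → ℝ)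
    (hexact : π.map (fun p => A.mulVec p.1 + B.mulVec p.2 + c) =
      μ.map (fun ω => Z ω + M.mulVec ystar))
    (hcov : IsUnit (covMat μ Z Z)) :
    (∀ l ∈ spectrum ℂ (A.map (Complex.ofReal)), ‖l‖ ≤ 1) ∧
    (∀ l ∈ spectrum ℂ (A.map (Complex.ofReal)), ‖l‖ = 1 →
      End.maxGenEigenspace (Matrix.toLin' (A.map (Complex.ofReal))) l =
        End.eigenspace (Matrix.toLin' (A.map (Complex.ofReal))) l) := by
  subst hπ hXdef
  have hZL : MemLp Z 2 μ := (memLp_two_iff_integrable_sq_norm hZ.aestronglyMeasurable).2 hZ2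
  have hYL : MemLp Y 2 μ := (memLp_two_iff_integrable_sq_norm hY.aestronglyMeasurable).2 hY2
  have hmul : ∀ {p q : ℕ} (N : Matrix (Fin p) (Fin q) ℝ), Measurable fun x => N *ᵥ x :=
    fun N => (Continuous.matrix_mulVec continuous_const continuous_id).measurable
  have hX : Measurable fun ω => Z ω + M *ᵥ Y ω := hZ.add ((hmul M).comp hY)
  have hl : Measurable fun p : (Fin n → ℝ) × (Fin m → ℝ) => A *ᵥ p.1 + B *ᵥ p.2 + c :=
    (((hmul A).comp measurable_fst).add ((hmul B).comp measurable_snd)).add_const c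
  rw [Measure.map_map hl (hX.prodMk hY)] at hexact
  have hid : IdentDistrib (fun ω => A *ᵥ (Z ω + M *ᵥ Y ω) + B *ᵥ Y ω + c)
      (fun ω => Z ω + M *ᵥ ystar) μ μ :=
    ⟨(hl.comp (hX.prodMk hY)).aemeasurable, (hZ.add_const _).aemeasurable, hexact⟩
  obtain ⟨C, hC⟩ := exists_abs_pow_apply_le (posSemidef_covMat hZL) hcov
    (covMat_transpose_mulVec_le hZL hYL hindep M A B c _ hid)
  have hA : ∀ k i j, |(A ^ k) i j| ≤ C := fun k i j => by
    simpa [← Matrix.transpose_pow] using hC k j i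
  have hbdd := toLin'_ofReal_power_bounded hA
  refine ⟨fun l hl => norm_le_one_of_power_bounded _ hbdd ?_, fun l _ hl =>
    maxGenEigenspace_eq_eigenspace_of_power_bounded _ hbdd hl⟩
  rwa [Module.End.hasEigenvalue_iff_mem_spectrum, Matrix.spectrum_toLin']
end

section
/- Let n,m ≥ 1, let Y be an ℝᵐ-valued random vector and Z an ℝⁿ-valued random vector independent of Y, both with finite second moments, let M ∈ ℝ^{n×m}, set X = Z + MY, and let π be the law of (X,Y). Fix y⋆ ∈ ℝᵐ and suppose the affine map ℓ(x,y) = Ax + By + c (A ∈ ℝ^{n×n}, B ∈ ℝ^{n×m}, c ∈ ℝⁿ) satisfies ℓ_♯π = Law(Z + My⋆). If π ∉ S_cyc, then A has no complex eigenvalue λ with |λ| = 1 and λ ≠ 1. -/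
open MeasureTheory ProbabilityTheory Matrix

/-- Counterclockwise rotation of the plane `ℝ²` (modelled as `ℝ × ℝ`) by angle `θ`. -/
noncomputable def rot2 (θ : ℝ) (p : ℝ × ℝ) : ℝ × ℝ :=
  (Real.cos θ * p.1 - Real.sin θ * p.2, Real.sin θ * p.1 + Real.cos θ * p.2)

/-- Membership of (the law of `(Z + MY, Y)`) in the symmetry class `S_cyc`: there are
nonzero `v₁, v₂ ∈ ℝⁿ` and an integer `k ≥ 2` such that the planar vector
`(v₁ᵀ Z̄, v₂ᵀ Z̄)` is invariant in distribution under the rotation by `2π/k`. -/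
def InScyc {Ω : Type*} [MeasurableSpace Ω] (μ : Measure Ω) {n : ℕ}
    (Z : Ω → Fin n → ℝ) : Prop :=
  ∃ v₁ v₂ : Fin n → ℝ, v₁ ≠ 0 ∧ v₂ ≠ 0 ∧ ∃ k : ℕ, 2 ≤ k ∧
    μ.map (fun ω =>
        ((∑ i, v₁ i * (Z ω i - ∫ ω', Z ω' i ∂μ)),
         (∑ i, v₂ i * (Z ω i - ∫ ω', Z ω' i ∂μ)))) =
      μ.map (fun ω => rot2 (2 * Real.pi / k)
        ((∑ i, v₁ i * (Z ω i - ∫ ω', Z ω' i ∂μ)),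
         (∑ i, v₂ i * (Z ω i - ∫ ω', Z ω' i ∂μ))))

/-- If an independent noise term does not change the law of a rotated square-integrable complex
random variable, then the centred variable is invariant in law under that rotation. -/
lemma map_mul_centered_eq_of_indepFun {Ω : Type*} [MeasurableSpace Ω] (μ : Measure Ω)
    [IsProbabilityMeasure μ] {U V : Ω → ℂ} (hU : Measurable U) (hV : Measurable V)
    (hU2 : MemLp U 2 μ) (hV2 : MemLp V 2 μ) (hUV : IndepFun U V μ) {l : ℂ} (hl : ‖l‖ = 1)
    (h : μ.map (fun ω => l * U ω + V ω) = μ.map U) :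
    μ.map (fun ω => l * (U ω - ∫ ω', U ω' ∂μ)) = μ.map (fun ω => U ω - ∫ ω', U ω' ∂μ) := by
  set a := ∫ ω', U ω' ∂μ with ha
  set b := ∫ ω', V ω' ∂μ
  have hUi : Integrable U μ := hU2.integrable (by norm_num)
  have hVi : Integrable V μ := hV2.integrable (by norm_num)
  have hS : Measurable (fun ω => l * U ω + V ω) := by fun_prop
  have hid : IdentDistrib (fun ω => l * U ω + V ω) U μ μ := ⟨hS.aemeasurable, hU.aemeasurable, h⟩
  have hmean : l * a + b = a := by
    have := hid.integral_eq
    rwa [integral_add (hUi.const_mul l) hVi, integral_const_mul] at this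
  have hid' : IdentDistrib (fun ω => l * U ω + V ω - a) (fun ω => U ω - a) μ μ :=
    hid.comp (u := fun z : ℂ => z - a) (by fun_prop)
  have hU0 : MemLp (fun ω => l * (U ω - a)) 2 μ := (hU2.sub (memLp_const a)).const_mul l
  have hV0 : MemLp (fun ω => V ω - b) 2 μ := hV2.sub (memLp_const b)
  have hUc : MemLp (fun ω => U ω - a) 2 μ := hU2.sub (memLp_const a)
  have hsq : ∫ ω, ‖l * (U ω - a) + (V ω - b)‖ ^ 2 ∂μ = ∫ ω, ‖U ω - a‖ ^ 2 ∂μ := by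
    have := (hid'.comp (u := fun z : ℂ => ‖z‖ ^ 2) (by fun_prop)).integral_eq
    simp only [Function.comp_def] at this
    rw [← this]
    congr 1
    ext ω
    congr 2
    linear_combination -hmean
  have hcross : ∫ ω, (l * (U ω - a)) * (starRingEnd ℂ) (V ω - b) ∂μ = 0 := by
    have hind : IndepFun (fun ω => l * (U ω - a)) (fun ω => (starRingEnd ℂ) (V ω - b)) μ :=
      hUV.comp (φ := fun z : ℂ => l * (z - a)) (ψ := fun z : ℂ => (starRingEnd ℂ) (z - b))
        (by fun_prop) (Complex.continuous_conj.measurable.comp (by fun_prop))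
    rw [hind.integral_fun_mul_eq_mul_integral hU0.1
      (Complex.continuous_conj.comp_aestronglyMeasurable hV0.1), integral_const_mul,
      integral_sub hUi (integrable_const a)]
    simp [← ha]
  have hcrossi : Integrable (fun ω => (l * (U ω - a)) * (starRingEnd ℂ) (V ω - b)) μ :=
    hU0.integrable_mul hV0.star
  have hexp : ∀ ω, ‖l * (U ω - a) + (V ω - b)‖ ^ 2 =
      ‖U ω - a‖ ^ 2 + (‖V ω - b‖ ^ 2
        + 2 * ((l * (U ω - a)) * (starRingEnd ℂ) (V ω - b)).re) := by
    intro ω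
    rw [Complex.sq_norm, Complex.normSq_add, ← Complex.sq_norm, ← Complex.sq_norm, norm_mul, hl]
    ring
  have hV2i : Integrable (fun ω => ‖V ω - b‖ ^ 2) μ := hV0.integrable_norm_pow (by norm_num)
  have hU2i : Integrable (fun ω => ‖U ω - a‖ ^ 2) μ := hUc.integrable_norm_pow (by norm_num)
  have hrei : Integrable
      (fun ω => 2 * ((l * (U ω - a)) * (starRingEnd ℂ) (V ω - b)).re) μ :=
    hcrossi.re.const_mul 2
  have hre : ∫ ω, ((l * (U ω - a)) * (starRingEnd ℂ) (V ω - b)).re ∂μ = 0 := by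
    have := integral_re hcrossi
    rw [hcross] at this
    simpa using this
  have hVzero : ∫ ω, ‖V ω - b‖ ^ 2 ∂μ = 0 := by
    simp_rw [hexp] at hsq
    rw [integral_add hU2i (by exact hV2i.add hrei), integral_add hV2i hrei, integral_const_mul,
      hre] at hsq
    linarith
  have hVae : ∀ᵐ ω ∂μ, V ω = b := by
    rw [integral_eq_zero_iff_of_nonneg (fun ω => by positivity) hV2i] at hVzero
    filter_upwards [hVzero] with ω hω
    simpa [sub_eq_zero] using hω
  rw [← hid'.map_eq]
  refine Measure.map_congr ?_
  filter_upwards [hVae] with ω hω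
  rw [hω]
  linear_combination -hmean

/-- The angles of the rotations of `ℂ` preserving a measure form an additive subgroup of `ℝ`. -/
noncomputable def rotationAngles (ν : Measure ℂ) : AddSubgroup ℝ where
  carrier := {θ | ν.map (fun z => Complex.exp (θ * Complex.I) * z) = ν}
  zero_mem' := by simp
  add_mem' := by
    intro s t hs ht
    simp only [Set.mem_ofPred_eq] at *
    conv_rhs => rw [← hs, ← ht]
    rw [Measure.map_map (by fun_prop) (by fun_prop)]
    congr 1
    ext z
    simp [add_mul, Complex.exp_add, mul_assoc]
  neg_mem' := by
    intro s hs
    simp only [Set.mem_ofPred_eq] at *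
    conv_lhs => rw [← hs]
    rw [Measure.map_map (by fun_prop) (by fun_prop)]
    convert! Measure.map_id
    ext z
    simp [← mul_assoc, ← Complex.exp_add]

lemma mem_rotationAngles {ν : Measure ℂ} {θ : ℝ} :
    θ ∈ rotationAngles ν ↔ ν.map (fun z => Complex.exp (θ * Complex.I) * z) = ν := Iff.rfl

lemma isClosed_rotationAngles (ν : Measure ℂ) [IsProbabilityMeasure ν] :
    IsClosed (rotationAngles ν : Set ℝ) := by
  have heq : (rotationAngles ν : Set ℝ) =
      ⋂ t : ℂ, {θ : ℝ | charFun (ν.map (fun z => Complex.exp (θ * Complex.I) * z)) t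
        = charFun ν t} := by
    ext θ
    simp only [SetLike.mem_coe, mem_rotationAngles, Set.mem_iInter, Set.mem_ofPred_eq]
    refine ⟨fun h t => by rw [h], fun h => ?_⟩
    have : IsProbabilityMeasure (ν.map (fun z => Complex.exp (θ * Complex.I) * z)) :=
      Measure.isProbabilityMeasure_map (by fun_prop)
    exact Measure.ext_of_charFun (funext h)
  rw [heq]
  refine isClosed_iInter fun t => isClosed_eq ?_ continuous_const
  have : ∀ θ : ℝ, charFun (ν.map (fun z => Complex.exp (θ * Complex.I) * z)) t =
      ∫ z, Complex.exp (inner ℝ (Complex.exp (θ * Complex.I) * z) t * Complex.I) ∂ν := by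
    intro θ
    rw [charFun_apply, integral_map (by fun_prop)
      (by apply Continuous.aestronglyMeasurable; fun_prop)]
  simp_rw [this]
  refine continuous_of_dominated (bound := fun _ => 1) ?_ ?_ (integrable_const _) ?_
  · intro θ
    apply Continuous.aestronglyMeasurable
    fun_prop
  · intro θ
    exact Filter.Eventually.of_forall fun z => by rw [Complex.norm_exp_ofReal_mul_I]
  · exact Filter.Eventually.of_forall fun z => by fun_prop

/-- A planar law invariant under a nontrivial rotation is invariant under the rotation by `2π/k`
for some `k ≥ 2`. -/
lemma exists_two_pi_div_mem_rotationAngles (ν : Measure ℂ) [IsProbabilityMeasure ν] {l : ℂ}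
    (hl : ‖l‖ = 1) (hl1 : l ≠ 1) (h : ν.map (fun z => l * z) = ν) :
    ∃ k : ℕ, 2 ≤ k ∧ 2 * Real.pi / k ∈ rotationAngles ν := by
  have hlarg : Complex.exp (l.arg * Complex.I) = l := by
    simpa [hl] using Complex.norm_mul_exp_arg_mul_I l
  have harg : l.arg ∈ rotationAngles ν := by
    rw [mem_rotationAngles, hlarg, h]
  have hpi : 2 * Real.pi ∈ rotationAngles ν := by
    rw [mem_rotationAngles]
    simp
  rcases (rotationAngles ν).dense_or_cyclic with hd | ⟨a, ha⟩
  · refine ⟨2, le_rfl, ?_⟩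
    have : (rotationAngles ν : Set ℝ) = Set.univ := by
      rw [← (isClosed_rotationAngles ν).closure_eq, hd.closure_eq]
    rw [← SetLike.mem_coe, this]
    trivial
  · have haS : a ∈ rotationAngles ν := by
      rw [ha]
      exact AddSubgroup.mem_closure_singleton_self a
    obtain ⟨p, hp⟩ := AddSubgroup.mem_closure_singleton.1 (ha ▸ harg)
    obtain ⟨q, hq⟩ := AddSubgroup.mem_closure_singleton.1 (ha ▸ hpi)
    rw [zsmul_eq_mul] at hp hq
    have hq0 : q ≠ 0 := by
      rintro rfl
      simp at hq
    have hqR : (q : ℝ) ≠ 0 := by exact_mod_cast hq0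
    have hmem : 2 * Real.pi / (q.natAbs : ℝ) ∈ rotationAngles ν := by
      rw [Nat.cast_natAbs, Int.cast_abs, ← hq]
      rcases abs_choice (q : ℝ) with h' | h' <;> rw [h']
      · rwa [mul_div_cancel_left₀ _ hqR]
      · rw [div_neg, mul_div_cancel_left₀ _ hqR]
        exact neg_mem haS
    refine ⟨q.natAbs, ?_, hmem⟩
    by_contra hlt
    have hq1 : q = 1 ∨ q = -1 := by omega
    apply hl1
    rw [← hlarg, Complex.exp_eq_one_iff]
    rcases hq1 with rfl | rfl
    · refine ⟨p, ?_⟩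
      have : a = 2 * Real.pi := by simpa using hq
      rw [← hp, this]
      push_cast
      ring
    · refine ⟨-p, ?_⟩
      have : a = -(2 * Real.pi) := by
        push_cast at hq
        linarith
      rw [← hp, this]
      push_cast
      ring

/-- A complex eigenvalue of a real matrix is realised by a nonzero complex-valued functional. -/
lemma exists_functional_of_mem_spectrum {n : ℕ} (A : Matrix (Fin n) (Fin n) ℝ) {l : ℂ}
    (hl : l ∈ spectrum ℂ (A.map Complex.ofReal)) :
    ∃ L : (Fin n → ℝ) →L[ℝ] ℂ, L ≠ 0 ∧ ∀ x, L (A.mulVec x) = l * L x := by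
  rw [spectrum.mem_iff, Matrix.isUnit_iff_isUnit_det, isUnit_iff_ne_zero, not_not] at hl
  obtain ⟨w, hw, hw0⟩ := Matrix.exists_vecMul_eq_zero_iff.2 hl
  let L : (Fin n → ℝ) →L[ℝ] ℂ :=
    ∑ i, (ContinuousLinearMap.proj (R := ℝ) (φ := fun _ : Fin n => ℝ) i).smulRight (w i)
  have hL : ∀ x, L x = w ⬝ᵥ (fun i => (x i : ℂ)) := by
    intro x
    simp [L, dotProduct, mul_comm]
  refine ⟨L, ?_, fun x => ?_⟩
  · intro h0
    apply hw
    ext i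
    have := hL (Pi.single i 1)
    rw [h0] at this
    simpa [dotProduct, Pi.single_apply, apply_ite Complex.ofReal] using this.symm
  · have hA : (fun i => ((A.mulVec x i : ℝ) : ℂ)) =
        (A.map Complex.ofReal).mulVec (fun i => (x i : ℂ)) := by
      ext i
      simp [Matrix.mulVec, dotProduct]
    have hwA : w ᵥ* (A.map Complex.ofReal) = l • w := by
      rw [Matrix.vecMul_sub, sub_eq_zero] at hw0
      rw [← hw0, Algebra.algebraMap_eq_smul_one, Matrix.vecMul_smul, Matrix.vecMul_one]
    rw [hL, hL, hA, Matrix.dotProduct_mulVec, hwA, smul_dotProduct, smul_eq_mul]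

lemma rot2_re_im (θ : ℝ) (z : ℂ) :
    rot2 θ (z.re, z.im) = ((Complex.exp (θ * Complex.I) * z).re,
      (Complex.exp (θ * Complex.I) * z).im) := by
  simp [rot2, Complex.exp_ofReal_mul_I_re, Complex.exp_ofReal_mul_I_im, add_comm]

/-- A functional whose centred image of `Z` is invariant in law under multiplication by a
unit `l ≠ 1`, and which has nonzero real and imaginary parts, witnesses cyclic symmetry. -/
lemma inScyc_of_functional {Ω : Type*} [MeasurableSpace Ω] (μ : Measure Ω)
    [IsProbabilityMeasure μ] {n : ℕ} {Z : Ω → Fin n → ℝ} (hZ : Measurable Z)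
    (hZi : Integrable Z μ) (L : (Fin n → ℝ) →L[ℝ] ℂ)
    (hre : ∃ x, (L x).re ≠ 0) (him : ∃ x, (L x).im ≠ 0) {l : ℂ} (hl : ‖l‖ = 1) (hl1 : l ≠ 1)
    (h : μ.map (fun ω => l * (L (Z ω) - ∫ ω', L (Z ω') ∂μ)) =
      μ.map (fun ω => L (Z ω) - ∫ ω', L (Z ω') ∂μ)) : InScyc μ Z := by
  have hsum : ∀ x, L x = ∑ i, (x i : ℂ) * L (Pi.single i 1) := by
    intro x
    conv_lhs => rw [pi_eq_sum_univ' x, map_sum]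
    refine Finset.sum_congr rfl fun i _ => ?_
    rw [map_smul, Complex.real_smul]
  have hsum_re : ∀ x, (L x).re = ∑ i, (L (Pi.single i 1)).re * x i := by
    intro x
    rw [hsum, Complex.re_sum]
    exact Finset.sum_congr rfl fun i _ => by rw [Complex.re_ofReal_mul, mul_comm]
  have hsum_im : ∀ x, (L x).im = ∑ i, (L (Pi.single i 1)).im * x i := by
    intro x
    rw [hsum, Complex.im_sum]
    exact Finset.sum_congr rfl fun i _ => by rw [Complex.im_ofReal_mul, mul_comm]
  have hcent : ∀ ω, L (Z ω) - ∫ ω', L (Z ω') ∂μ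
      = L (fun i => Z ω i - ∫ ω', Z ω' i ∂μ) := by
    intro ω
    rw [L.integral_comp_comm hZi, ← map_sub]
    congr 1
    ext i
    rw [Pi.sub_apply, eval_integral (fun j => hZi.eval j)]
  set ζ : Ω → ℂ := fun ω => L (Z ω) - ∫ ω', L (Z ω') ∂μ
  have hζm : Measurable ζ := (L.measurable.comp hZ).sub_const _
  have hpm : IsProbabilityMeasure (μ.map ζ) := Measure.isProbabilityMeasure_map hζm.aemeasurable
  have hinv : (μ.map ζ).map (fun z => l * z) = μ.map ζ := by
    rw [Measure.map_map (by fun_prop) hζm]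
    exact h
  obtain ⟨k, hk, hmem⟩ := exists_two_pi_div_mem_rotationAngles (μ.map ζ) hl hl1 hinv
  refine ⟨fun i => (L (Pi.single i 1)).re, fun i => (L (Pi.single i 1)).im, ?_, ?_, k, hk, ?_⟩
  · intro h0
    obtain ⟨x, hx⟩ := hre
    refine hx ?_
    rw [hsum_re]
    exact Finset.sum_eq_zero fun i _ => by rw [congrFun h0 i, Pi.zero_apply, zero_mul]
  · intro h0
    obtain ⟨x, hx⟩ := him
    refine hx ?_
    rw [hsum_im]
    exact Finset.sum_eq_zero fun i _ => by rw [congrFun h0 i, Pi.zero_apply, zero_mul]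
  · have hpair : ∀ ω, (∑ i, (L (Pi.single i 1)).re * (Z ω i - ∫ ω', Z ω' i ∂μ),
        ∑ i, (L (Pi.single i 1)).im * (Z ω i - ∫ ω', Z ω' i ∂μ)) = ((ζ ω).re, (ζ ω).im) := by
      intro ω
      rw [show ζ ω = _ from hcent ω, hsum_re, hsum_im]
    simp_rw [hpair, rot2_re_im]
    have hmeas : Measurable (fun z : ℂ => (z.re, z.im)) := by fun_prop
    rw [mem_rotationAngles, Measure.map_map (by fun_prop) hζm] at hmem
    have := congrArg (Measure.map (fun z : ℂ => (z.re, z.im))) hmem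
    rw [Measure.map_map hmeas (by fun_prop), Measure.map_map hmeas hζm] at this
    exact this.symm

/-- Let `X = Z + MY` with `Z` independent of `Y` (finite second moments),
let `π` be the law of `(X,Y)`, and suppose `ℓ(x,y) = Ax + By + c` pushes `π` forward to
`Law(Z + M y⋆)`.  If `π ∉ S_cyc`, then `A` has no complex eigenvalue `λ` with `|λ| = 1`
and `λ ≠ 1`. -/
theorem exact_affine_map_no_cyclic_eigenvalues {n m : ℕ} (hn : 1 ≤ n) (hm : 1 ≤ m)
    {Ω : Type*} [MeasurableSpace Ω] (μ : Measure Ω) [IsProbabilityMeasure μ]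
    (Z : Ω → Fin n → ℝ) (Y : Ω → Fin m → ℝ) (hZ : Measurable Z) (hY : Measurable Y)
    (hZ2 : Integrable (fun ω => ‖Z ω‖ ^ 2) μ) (hY2 : Integrable (fun ω => ‖Y ω‖ ^ 2) μ)
    (hindep : IndepFun Z Y μ)
    (M : Matrix (Fin n) (Fin m) ℝ)
    (X : Ω → Fin n → ℝ) (hXdef : X = fun ω => Z ω + M.mulVec (Y ω))
    (π : Measure ((Fin n → ℝ) × (Fin m → ℝ)))
    (hπ : π = μ.map (fun ω => (X ω, Y ω)))
    (ystar : Fin m → ℝ)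
    (A : Matrix (Fin n) (Fin n) ℝ) (B : Matrix (Fin n) (Fin m) ℝ) (c : Fin n → ℝ)
    (hexact : π.map (fun p => A.mulVec p.1 + B.mulVec p.2 + c) =
      μ.map (fun ω => Z ω + M.mulVec ystar))
    (hnotcyc : ¬ InScyc μ Z) :
    ∀ l ∈ spectrum ℂ (A.map (Complex.ofReal)), ¬ (‖l‖ = 1 ∧ l ≠ 1) := by
  rintro l hl ⟨hl1, hlne⟩
  apply hnotcyc
  obtain ⟨L, hL0, hL⟩ := exists_functional_of_mem_spectrum A hl
  have hZL : MemLp Z 2 μ := (memLp_two_iff_integrable_sq_norm hZ.aestronglyMeasurable).2 hZ2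
  have hYL : MemLp Y 2 μ := (memLp_two_iff_integrable_sq_norm hY.aestronglyMeasurable).2 hY2
  have hZi : Integrable Z μ := hZL.integrable (by norm_num)
  let T : (Fin m → ℝ) →L[ℝ] ℂ :=
    L.comp (LinearMap.toContinuousLinearMap (A * M + B).mulVecLin)
  have hT : ∀ y, T y = l * L (M.mulVec y) + L (B.mulVec y) := fun y => by
    rw [← hL, ← map_add, Matrix.mulVec_mulVec, ← Matrix.add_mulVec]
    rfl
  let d : ℂ := L (c - M.mulVec ystar)
  have hTm : Measurable (fun y => T y + d) := T.measurable.add_const d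
  have hAm : Measurable (fun p : (Fin n → ℝ) × (Fin m → ℝ) =>
      A.mulVec p.1 + B.mulVec p.2 + c) := by
    apply Continuous.measurable
    fun_prop
  have hMm : Measurable (fun y : Fin m → ℝ => M.mulVec y) := by
    apply Continuous.measurable
    fun_prop
  have hlaw : μ.map (fun ω => l * L (Z ω) + (T (Y ω) + d)) = μ.map (fun ω => L (Z ω)) := by
    have hXY : Measurable (fun ω => (Z ω + M.mulVec (Y ω), Y ω)) :=
      (hZ.add (hMm.comp hY)).prodMk hY
    have hf : Measurable (fun x : Fin n → ℝ => L x - L (M.mulVec ystar)) :=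
      L.measurable.sub_const _
    have := congrArg (Measure.map (fun x : Fin n → ℝ => L x - L (M.mulVec ystar))) hexact
    rw [hπ, hXdef, Measure.map_map hAm hXY, Measure.map_map hf (hAm.comp hXY),
      Measure.map_map hf (hZ.add_const _)] at this
    convert! this using 2
    · ext1 ω
      simp only [Function.comp_apply, hT, map_add, hL, d, map_sub]
      ring
    · ext1 ω
      simp
  have hinv := map_mul_centered_eq_of_indepFun μ (U := fun ω => L (Z ω))
    (V := fun ω => T (Y ω) + d) (L.measurable.comp hZ) (hTm.comp hY)
    (L.comp_memLp' hZL) ((T.comp_memLp' hYL).add (memLp_const d))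
    (hindep.comp L.measurable hTm) hl1 hlaw
  obtain ⟨x, hx⟩ : ∃ x, L x ≠ 0 := by
    by_contra! h0
    exact hL0 (ContinuousLinearMap.ext h0)
  by_cases him : l.im = 0
  · -- Here `l = -1`, and multiplying `L` by a suitable constant makes both parts nonzero.
    obtain ⟨u, hu1, hu2⟩ : ∃ u : ℂ, (u * L x).re ≠ 0 ∧ (u * L x).im ≠ 0 :=
      ⟨(1 + Complex.I) / L x, by simp [div_mul_cancel₀ _ hx], by simp [div_mul_cancel₀ _ hx]⟩
    refine inScyc_of_functional μ hZ hZi (u • L) ⟨x, hu1⟩ ⟨x, hu2⟩ hl1 hlne ?_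
    have := congrArg (Measure.map (fun z : ℂ => u * z)) hinv
    have hLm : Measurable (fun ω => L (Z ω) - ∫ ω', L (Z ω') ∂μ) :=
      (L.measurable.comp hZ).sub_const _
    rw [Measure.map_map (by fun_prop) (hLm.const_mul l), Measure.map_map (by fun_prop) hLm] at this
    convert! this using 2 <;>
    · ext1 ω
      simp only [_root_.smul_apply, smul_eq_mul, integral_const_mul,
        Function.comp_apply]
      ring
  · refine inScyc_of_functional μ hZ hZi L ?_ ?_ hl1 hlne hinv
    · by_contra! h0
      have h1 := h0 (A.mulVec x)
      rw [hL, Complex.mul_re, h0 x] at h1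
      have : (L x).im = 0 := by simpa [him] using h1
      exact hx (Complex.ext (h0 x) this)
    · by_contra! h0
      have h1 := h0 (A.mulVec x)
      rw [hL, Complex.mul_im, h0 x] at h1
      have : (L x).re = 0 := by simpa [him] using h1
      exact hx (Complex.ext this (h0 x))
end

section
/- Let n,m ≥ 1 and let π ∈ P₂(ℝⁿ×ℝᵐ) be the law of (X,Y). Suppose there exist matrices A ∈ ℝ^{n×n}, B ∈ ℝ^{n×m}, a function c : ℝᵐ → ℝⁿ, a Markov kernel y ↦ κ(y) that is a version of the conditional distribution of X given Y, and a Borel set Q ⊆ ℝᵐ with π_Y(Q) = 1, such that for every y⋆ ∈ Q the pushforward of π under (x,y) ↦ Ax + By + c(y⋆) equals κ(y⋆). Then there exist a Borel measurable function d : ℝᵐ → ℝⁿ and ν ∈ P₂(ℝⁿ) such that κ(y⋆) = T_{d(y⋆)}ν for every y⋆ ∈ Q; in particular y ↦ T_{d(y)}ν is a Markov kernel giving a version of the conditional distribution of X given Y. -/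
open MeasureTheory ProbabilityTheory Matrix
open scoped ENNReal

/-- The translation operator `T_h ν` on measures: pushforward of `ν` under `x ↦ x + h`. -/
noncomputable def translateMeasure {n : ℕ} (h : Fin n → ℝ) (ν : Measure (Fin n → ℝ)) :
    Measure (Fin n → ℝ) :=
  ν.map (fun x => x + h)

theorem translateMeasure_apply {n : ℕ} (h : Fin n → ℝ) (ν : Measure (Fin n → ℝ))
    {B : Set (Fin n → ℝ)} (hB : MeasurableSet B) :
    translateMeasure h ν B = ν {x | x + h ∈ B} :=
  Measure.map_apply (measurable_add_const h) hB

theorem isProbabilityMeasure_translateMeasure {n : ℕ} (h : Fin n → ℝ)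
    (ν : Measure (Fin n → ℝ)) [IsProbabilityMeasure ν] :
    IsProbabilityMeasure (translateMeasure h ν) :=
  Measure.isProbabilityMeasure_map (measurable_add_const h).aemeasurable

theorem integral_id_translateMeasure {n : ℕ} (h : Fin n → ℝ) (ν : Measure (Fin n → ℝ))
    [IsProbabilityMeasure ν] (hν : Integrable (fun x => x) ν) :
    ∫ x, x ∂(translateMeasure h ν) = ∫ x, x ∂ν + h := by
  rw [translateMeasure, integral_map (f := fun x => x) (measurable_add_const h).aemeasurable
    aestronglyMeasurable_id, integral_add hν (integrable_const h)]
  simp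

theorem measurable_translateMeasure_apply {n m : ℕ} {d : (Fin m → ℝ) → Fin n → ℝ}
    (hd : Measurable d) (ν : Measure (Fin n → ℝ)) [IsProbabilityMeasure ν]
    {B : Set (Fin n → ℝ)} (hB : MeasurableSet B) :
    Measurable fun y => translateMeasure (d y) ν B := by
  simp_rw [translateMeasure_apply _ ν hB]
  have hS : MeasurableSet {p : (Fin m → ℝ) × (Fin n → ℝ) | p.2 + d p.1 ∈ B} :=
    (measurable_snd.add (hd.comp measurable_fst)) hB
  exact measurable_measure_prodMk_left hS

theorem memLp_mulVec {Ω : Type*} [MeasurableSpace Ω] {μ : Measure Ω} {n m : ℕ}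
    (A : Matrix (Fin n) (Fin m) ℝ) {X : Ω → Fin m → ℝ} (hX : MemLp X 2 μ) :
    MemLp (fun ω => A.mulVec (X ω)) 2 μ :=
  A.mulVecLin.toContinuousLinearMap.comp_memLp' hX

/-- Let `π ∈ P₂(ℝⁿ×ℝᵐ)` be the law of `(X,Y)` and suppose there are
matrices `A, B`, a function `c : ℝᵐ → ℝⁿ`, a version `κ` of the conditional distribution
of `X` given `Y`, and a Borel set `Q` of full `π_Y`-measure such that for every `y⋆ ∈ Q`
the pushforward of `π` under `(x,y) ↦ Ax + By + c(y⋆)` equals `κ y⋆`.  Then there are a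
Borel measurable `d : ℝᵐ → ℝⁿ` and `ν ∈ P₂(ℝⁿ)` such that `κ y⋆ = T_{d(y⋆)} ν` for every
`y⋆ ∈ Q`; in particular `y ↦ T_{d(y)} ν` is a version of the conditional distribution of
`X` given `Y`. -/
theorem weakly_dependent_exact_implies_translation_family {n m : ℕ} (hn : 1 ≤ n) (hm : 1 ≤ m)
    {Ω : Type*} [MeasurableSpace Ω] (μ : Measure Ω) [IsProbabilityMeasure μ]
    (X : Ω → Fin n → ℝ) (Y : Ω → Fin m → ℝ) (hX : Measurable X) (hY : Measurable Y)
    (hX2 : Integrable (fun ω => ‖X ω‖ ^ 2) μ) (hY2 : Integrable (fun ω => ‖Y ω‖ ^ 2) μ)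
    (π : Measure ((Fin n → ℝ) × (Fin m → ℝ)))
    (hπ : π = μ.map (fun ω => (X ω, Y ω)))
    (A : Matrix (Fin n) (Fin n) ℝ) (B : Matrix (Fin n) (Fin m) ℝ)
    (c : (Fin m → ℝ) → Fin n → ℝ)
    (κ : (Fin m → ℝ) → Measure (Fin n → ℝ)) (hκ : IsCondDistrib μ X Y κ)
    (Q : Set (Fin m → ℝ)) (hQmeas : MeasurableSet Q) (hQfull : μ.map Y Q = 1)
    (hexact : ∀ ystar ∈ Q,
      π.map (fun p => A.mulVec p.1 + B.mulVec p.2 + c ystar) = κ ystar) :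
    ∃ d : (Fin m → ℝ) → Fin n → ℝ, Measurable d ∧
      ∃ ν : Measure (Fin n → ℝ), IsProbabilityMeasure ν ∧
        Integrable (fun x => ‖x‖ ^ 2) ν ∧
        (∀ ystar ∈ Q, κ ystar = translateMeasure (d ystar) ν) ∧
        IsCondDistrib μ X Y (fun y => translateMeasure (d y) ν) := by
  obtain ⟨hκmeas, hκprob, hκeq⟩ := hκ
  set Z : Ω → Fin n → ℝ := fun ω => A.mulVec (X ω) + B.mulVec (Y ω)
  have hlin : Measurable fun p : (Fin n → ℝ) × (Fin m → ℝ) => A.mulVec p.1 + B.mulVec p.2 :=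
    (by fun_prop : Continuous fun p : (Fin n → ℝ) × (Fin m → ℝ) =>
      A.mulVec p.1 + B.mulVec p.2).measurable
  have hZmeas : Measurable Z := hlin.comp (hX.prodMk hY)
  have hZ2 : MemLp Z 2 μ :=
    (memLp_mulVec A ((memLp_two_iff_integrable_sq_norm hX.aestronglyMeasurable).2 hX2)).add
      (memLp_mulVec B ((memLp_two_iff_integrable_sq_norm hY.aestronglyMeasurable).2 hY2))
  set ν : Measure (Fin n → ℝ) := μ.map Z with hν
  have hνprob : IsProbabilityMeasure ν := Measure.isProbabilityMeasure_map hZmeas.aemeasurable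
  have hν2 : MemLp (fun x => x) 2 ν :=
    (memLp_map_measure_iff aestronglyMeasurable_id hZmeas.aemeasurable).2 hZ2
  have hκc : ∀ y ∈ Q, κ y = translateMeasure (c y) ν := by
    intro y hy
    rw [← hexact y hy, hπ, translateMeasure, hν,
      Measure.map_map (hlin.add_const _) (hX.prodMk hY),
      Measure.map_map (measurable_add_const (c y)) hZmeas]
    rfl
  let K : Kernel (Fin m → ℝ) (Fin n → ℝ) := ⟨κ, Measure.measurable_of_measurable_coe κ hκmeas⟩
  have : IsMarkovKernel K := ⟨hκprob⟩
  have hmean : Measurable fun y => ∫ x, x ∂(κ y) :=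
    (StronglyMeasurable.integral_kernel (κ := K) stronglyMeasurable_id).measurable
  let d : (Fin m → ℝ) → Fin n → ℝ := fun y => ∫ x, x ∂(κ y) - ∫ x, x ∂ν
  have hd : Measurable d := hmean.sub_const _
  have hκd : ∀ y ∈ Q, κ y = translateMeasure (d y) ν := by
    intro y hy
    have hdc : d y = c y := by
      simp only [d]
      rw [hκc y hy, integral_id_translateMeasure _ _ (hν2.integrable one_le_two),
        add_sub_cancel_left]
    rw [hdc, hκc y hy]
  refine ⟨d, hd, ν, hνprob, hν2.integrable_norm_pow two_ne_zero, hκd,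
    fun S hS => measurable_translateMeasure_apply hd ν hS,
    fun y => isProbabilityMeasure_translateMeasure _ ν, fun S hS T hT => ?_⟩
  have : IsProbabilityMeasure (μ.map Y) := Measure.isProbabilityMeasure_map hY.aemeasurable
  have hQae : ∀ᵐ y ∂(μ.map Y), y ∈ Q := (mem_ae_iff_prob_eq_one hQmeas).2 hQfull
  rw [hκeq S hS T hT]
  refine lintegral_congr_ae (ae_restrict_of_ae ?_)
  filter_upwards [hQae] with y hy
  rw [hκd y hy]
end

section
/- Let A ∈ ℝ^{n×n} be such that every complex eigenvalue of A has modulus strictly greater than 1. Let X and U be independent ℝⁿ-valued random vectors with E‖X‖² < ∞ and E‖U‖² < ∞, satisfying the fixed-point-in-law equation X =_d AX + U. Then U is almost surely equal to a constant vector, X is almost surely equal to a constant vector, and, since I − A is invertible, X = (I − A)⁻¹U almost surely. -/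
open MeasureTheory ProbabilityTheory Matrix

open Filter Topology in
theorem tendsto_pow_zero_of_spectralRadius_lt_one {E : Type*} [NormedRing E] [NormedAlgebra ℂ E]
    [CompleteSpace E] {a : E} (ha : spectralRadius ℂ a < 1) :
    Tendsto (fun k : ℕ => a ^ k) atTop (𝓝 0) := by
  obtain ⟨r, har, hr1⟩ := ENNReal.lt_iff_exists_nnreal_btwn.1 ha
  have hr : (r : ℝ) < 1 := by exact_mod_cast hr1
  rw [tendsto_zero_iff_norm_tendsto_zero]
  refine squeeze_zero' (Eventually.of_forall fun k => norm_nonneg _) ?_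
    (tendsto_pow_atTop_nhds_zero_of_lt_one r.coe_nonneg hr)
  filter_upwards [(spectrum.pow_nnnorm_pow_one_div_tendsto_nhds_spectralRadius a).eventually_lt_const
    har, eventually_gt_atTop 0] with k hk hk0
  have h := (ENNReal.rpow_lt_rpow_iff (Nat.cast_pos.2 hk0 : (0 : ℝ) < k)).2 hk
  rw [← ENNReal.rpow_mul, one_div_mul_cancel (by positivity), ENNReal.rpow_one,
    ENNReal.rpow_natCast] at h
  exact_mod_cast h.le

theorem spectralRadius_inv_lt_one {E : Type*} [NormedRing E] [NormedAlgebra ℂ E]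
    [CompleteSpace E] [Nontrivial E] {a : Eˣ} (ha : ∀ l ∈ spectrum ℂ (a : E), 1 < ‖l‖) :
    spectralRadius ℂ (↑a⁻¹ : E) < 1 := by
  refine spectrum.spectralRadius_lt_of_forall_lt (r := 1) _ fun z hz => ?_
  have hz0 : z ≠ 0 := spectrum.ne_zero_of_mem_of_unit hz
  have h := ha z⁻¹ (by simpa using spectrum.inv₀_mem hz)
  rw [norm_inv] at h
  exact (one_lt_inv₀ (norm_pos_iff.2 hz0)).1 h

theorem isUnit_of_isUnit_map_ofReal {n : ℕ} {A : Matrix (Fin n) (Fin n) ℝ}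
    (h : IsUnit (A.map Complex.ofReal)) : IsUnit A := by
  rw [isUnit_iff_isUnit_det, isUnit_iff_ne_zero] at h ⊢
  intro h0
  have := RingHom.map_det Complex.ofRealHom A
  rw [h0, map_zero] at this
  exact h this.symm

theorem isUnit_of_one_lt_norm_spectrum {n : ℕ} {A : Matrix (Fin n) (Fin n) ℝ}
    (hspec : ∀ l ∈ spectrum ℂ (A.map (Complex.ofReal)), 1 < ‖l‖) : IsUnit A := by
  refine isUnit_of_isUnit_map_ofReal (spectrum.zero_notMem_iff ℂ |>.1 fun h => ?_)
  exact absurd (hspec 0 h) (by norm_num)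

theorem isUnit_one_sub_of_one_lt_norm_spectrum {n : ℕ} {A : Matrix (Fin n) (Fin n) ℝ}
    (hspec : ∀ l ∈ spectrum ℂ (A.map (Complex.ofReal)), 1 < ‖l‖) : IsUnit (1 - A) := by
  apply isUnit_of_isUnit_map_ofReal
  have h : (1 : ℂ) ∉ spectrum ℂ (A.map (Complex.ofReal)) := fun h => by simpa using hspec 1 h
  rw [spectrum.notMem_iff, map_one] at h
  rwa [Matrix.map_sub _ Complex.ofReal_sub,
    Matrix.map_one _ Complex.ofReal_zero Complex.ofReal_one]

open Filter Topology in
attribute [local instance] Matrix.linftyOpNormedRing Matrix.linftyOpNormedAlgebra in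
theorem tendsto_inv_pow_apply_of_one_lt_norm_spectrum {n : ℕ} {A : Matrix (Fin n) (Fin n) ℝ}
    (hspec : ∀ l ∈ spectrum ℂ (A.map (Complex.ofReal)), 1 < ‖l‖) (i j : Fin n) :
    Tendsto (fun k : ℕ => (A⁻¹ ^ k) i j) atTop (𝓝 0) := by
  have : Nonempty (Fin n) := ⟨i⟩
  have hA := isUnit_of_one_lt_norm_spectrum hspec
  have hmul : A.map Complex.ofReal * A⁻¹.map Complex.ofReal = 1 := by
    have := congrArg Complex.ofRealHom.mapMatrix
      (mul_nonsing_inv A ((isUnit_iff_isUnit_det A).1 hA))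
    rwa [map_mul, map_one] at this
  let u : (Matrix (Fin n) (Fin n) ℂ)ˣ :=
    ⟨A.map Complex.ofReal, A⁻¹.map Complex.ofReal, hmul, mul_eq_one_comm.1 hmul⟩
  have hρ : spectralRadius ℂ (A⁻¹.map Complex.ofReal) < 1 :=
    spectralRadius_inv_lt_one (a := u) hspec
  have hc : Continuous (entryLinearMap ℂ ℂ i j : Matrix (Fin n) (Fin n) ℂ →ₗ[ℂ] ℂ) :=
    LinearMap.continuous_of_finiteDimensional _
  have h := (hc.tendsto 0).comp (tendsto_pow_zero_of_spectralRadius_lt_one hρ)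
  have hre := (Complex.continuous_re.tendsto _).comp h
  rw [map_zero, Complex.zero_re] at hre
  refine hre.congr fun k => ?_
  have hk : (A⁻¹.map Complex.ofReal) ^ k = (A⁻¹ ^ k).map Complex.ofReal :=
    (map_pow Complex.ofRealHom.mapMatrix A⁻¹ k).symm
  simp [hk]

section Variance

variable {Ω ι : Type*} [MeasurableSpace Ω] [Fintype ι] {μ : Measure Ω}

theorem abs_dotProduct_le (v x : ι → ℝ) : |v ⬝ᵥ x| ≤ (∑ i, |v i|) * ‖x‖ := by
  rw [Finset.sum_mul]
  refine (Finset.abs_sum_le_sum_abs _ _).trans (Finset.sum_le_sum fun i _ => ?_)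
  rw [abs_mul]
  exact mul_le_mul_of_nonneg_left (norm_le_pi_norm x i) (abs_nonneg _)

theorem memLp_two_dotProduct {X : Ω → ι → ℝ} (hX : Measurable X)
    (hX2 : Integrable (fun ω => ‖X ω‖ ^ 2) μ) (v : ι → ℝ) :
    MemLp (fun ω => v ⬝ᵥ X ω) 2 μ := by
  have h : MemLp (fun ω => ‖X ω‖) 2 μ := (memLp_two_iff_integrable_sq (by fun_prop)).2 hX2
  refine (h.const_mul (∑ i, |v i|)).mono' ?_ (Filter.Eventually.of_forall fun ω => ?_)
  · unfold dotProduct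
    fun_prop
  · exact abs_dotProduct_le v (X ω)

theorem variance_dotProduct_le [IsProbabilityMeasure μ] {X : Ω → ι → ℝ} (hX : Measurable X)
    (hX2 : Integrable (fun ω => ‖X ω‖ ^ 2) μ) (v : ι → ℝ) :
    Var[fun ω => v ⬝ᵥ X ω; μ] ≤ (∑ i, |v i|) ^ 2 * ∫ ω, ‖X ω‖ ^ 2 ∂μ := by
  have hL := memLp_two_dotProduct hX hX2 v
  refine (variance_le_expectation_sq hL.aestronglyMeasurable).trans ?_
  rw [← integral_const_mul]
  refine integral_mono hL.integrable_sq (hX2.const_mul _) fun ω => ?_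
  simp only [Pi.pow_apply]
  rw [← mul_pow, ← sq_abs]
  exact pow_le_pow_left₀ (abs_nonneg _) (abs_dotProduct_le v (X ω)) 2

theorem variance_dotProduct_le_vecMul {A : Matrix ι ι ℝ}
    {X U : Ω → ι → ℝ} (hX : Measurable X) (hU : Measurable U)
    (hX2 : Integrable (fun ω => ‖X ω‖ ^ 2) μ) (hU2 : Integrable (fun ω => ‖U ω‖ ^ 2) μ)
    (hindep : IndepFun X U μ)
    (hfix : μ.map X = μ.map (fun ω => A.mulVec (X ω) + U ω)) (v : ι → ℝ) :
    Var[fun ω => (v ᵥ* A) ⬝ᵥ X ω; μ] ≤ Var[fun ω => v ⬝ᵥ X ω; μ] := by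
  have hm (w : ι → ℝ) : Measurable fun x : ι → ℝ => w ⬝ᵥ x := by
    unfold dotProduct
    fun_prop
  have hY : Measurable fun ω => A.mulVec (X ω) + U ω :=
    ((Continuous.matrix_mulVec continuous_const continuous_id).measurable.comp hX).add hU
  have hid : IdentDistrib X (fun ω => A.mulVec (X ω) + U ω) μ μ :=
    ⟨hX.aemeasurable, hY.aemeasurable, hfix⟩
  have h1 := (hid.comp (hm v)).variance_eq
  have h2 := IndepFun.variance_fun_add (memLp_two_dotProduct hX hX2 (v ᵥ* A))
    (memLp_two_dotProduct hU hU2 v) (hindep.comp (hm _) (hm _))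
  have h3 : ((fun x : ι → ℝ => v ⬝ᵥ x) ∘ fun ω => A.mulVec (X ω) + U ω) =
      fun ω => (v ᵥ* A) ⬝ᵥ X ω + v ⬝ᵥ U ω := by
    ext ω
    simp [dotProduct_add, dotProduct_mulVec]
  rw [h3, h2] at h1
  exact (le_add_of_nonneg_right (variance_nonneg _ _)).trans_eq h1.symm

end Variance

open Filter Topology in
theorem variance_dotProduct_eq_zero {n : ℕ} {A : Matrix (Fin n) (Fin n) ℝ}
    (hspec : ∀ l ∈ spectrum ℂ (A.map (Complex.ofReal)), 1 < ‖l‖)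
    {Ω : Type*} [MeasurableSpace Ω] {μ : Measure Ω} [IsProbabilityMeasure μ]
    {X U : Ω → Fin n → ℝ} (hX : Measurable X) (hU : Measurable U)
    (hX2 : Integrable (fun ω => ‖X ω‖ ^ 2) μ) (hU2 : Integrable (fun ω => ‖U ω‖ ^ 2) μ)
    (hindep : IndepFun X U μ)
    (hfix : μ.map X = μ.map (fun ω => A.mulVec (X ω) + U ω)) (w : Fin n → ℝ) :
    Var[fun ω => w ⬝ᵥ X ω; μ] = 0 := by
  have hA := (isUnit_iff_isUnit_det A).1 (isUnit_of_one_lt_norm_spectrum hspec)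
  have hle (k : ℕ) :
      Var[fun ω => w ⬝ᵥ X ω; μ] ≤ Var[fun ω => (w ᵥ* A⁻¹ ^ k) ⬝ᵥ X ω; μ] := by
    induction k with
    | zero => simp
    | succ k ih =>
      have h := variance_dotProduct_le_vecMul hX hU hX2 hU2 hindep hfix (w ᵥ* A⁻¹ ^ (k + 1))
      rw [vecMul_vecMul, pow_succ, mul_assoc, nonsing_inv_mul A hA, mul_one, ← pow_succ] at h
      exact ih.trans h
  have hv (j : Fin n) : Tendsto (fun k : ℕ => (w ᵥ* A⁻¹ ^ k) j) atTop (𝓝 0) := by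
    have := tendsto_finsetSum Finset.univ fun i _ =>
      (tendsto_inv_pow_apply_of_one_lt_norm_spectrum hspec i j).const_mul (w i)
    simpa [vecMul, dotProduct] using this
  have hbound : Tendsto (fun k : ℕ => (∑ j, |(w ᵥ* A⁻¹ ^ k) j|) ^ 2 * ∫ ω, ‖X ω‖ ^ 2 ∂μ)
      atTop (𝓝 0) := by
    have := ((tendsto_finsetSum Finset.univ fun j _ => (hv j).abs).pow 2).mul_const
      (∫ ω, ‖X ω‖ ^ 2 ∂μ)
    simpa using this
  exact le_antisymm
    (ge_of_tendsto' hbound fun k => (hle k).trans (variance_dotProduct_le hX hX2 _))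
    (variance_nonneg _ _)

/-- Let `A ∈ ℝ^{n×n}` have all complex eigenvalues of modulus strictly
greater than `1`.  If `X` and `U` are independent `ℝⁿ`-valued random vectors with finite
second moments satisfying `X =_d AX + U`, then `U` is a.s. constant, `X` is a.s. constant,
`I − A` is invertible, and `X = (I − A)⁻¹ U` almost surely. -/
theorem fixed_point_expanding_block {n : ℕ} (A : Matrix (Fin n) (Fin n) ℝ)
    (hspec : ∀ l ∈ spectrum ℂ (A.map (Complex.ofReal)), 1 < ‖l‖)
    {Ω : Type*} [MeasurableSpace Ω] (μ : Measure Ω) [IsProbabilityMeasure μ]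
    (X U : Ω → Fin n → ℝ) (hX : Measurable X) (hU : Measurable U)
    (hX2 : Integrable (fun ω => ‖X ω‖ ^ 2) μ) (hU2 : Integrable (fun ω => ‖U ω‖ ^ 2) μ)
    (hindep : IndepFun X U μ)
    (hfix : μ.map X = μ.map (fun ω => A.mulVec (X ω) + U ω)) :
    (∃ u₀ : Fin n → ℝ, ∀ᵐ ω ∂μ, U ω = u₀) ∧
    (∃ x₀ : Fin n → ℝ, ∀ᵐ ω ∂μ, X ω = x₀) ∧
    IsUnit (1 - A) ∧
    (∀ᵐ ω ∂μ, X ω = (1 - A)⁻¹.mulVec (U ω)) := by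
  have hunit := isUnit_one_sub_of_one_lt_norm_spectrum hspec
  have hXc : ∀ᵐ ω ∂μ, X ω = fun i => ∫ ω, X ω i ∂μ := by
    have h (i : Fin n) : ∀ᵐ ω ∂μ, X ω i = ∫ ω, X ω i ∂μ := by
      simpa using ae_eq_integral_of_variance_eq_zero
        (memLp_two_dotProduct hX hX2 (Pi.single i 1))
        (variance_dotProduct_eq_zero hspec hX hU hX2 hU2 hindep hfix (Pi.single i 1))
    filter_upwards [ae_all_iff.2 h] with ω hω
    exact funext hω
  set x₀ : Fin n → ℝ := fun i => ∫ ω, X ω i ∂μ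
  have hY : Measurable fun ω => A.mulVec (X ω) + U ω :=
    ((Continuous.matrix_mulVec continuous_const continuous_id).measurable.comp hX).add hU
  have hid : IdentDistrib X (fun ω => A.mulVec (X ω) + U ω) μ μ :=
    ⟨hX.aemeasurable, hY.aemeasurable, hfix⟩
  have hYc : ∀ᵐ ω ∂μ, A.mulVec (X ω) + U ω = x₀ :=
    hid.ae_snd (measurableSet_singleton x₀) hXc
  have hUc : ∀ᵐ ω ∂μ, U ω = (1 - A).mulVec x₀ := by
    filter_upwards [hXc, hYc] with ω h1 h2
    rw [h1] at h2
    rw [sub_mulVec, one_mulVec, eq_sub_iff_add_eq', h2]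
  refine ⟨⟨_, hUc⟩, ⟨_, hXc⟩, hunit, ?_⟩
  filter_upwards [hXc, hUc] with ω h1 h2
  rw [h1, h2, mulVec_mulVec, nonsing_inv_mul _ ((isUnit_iff_isUnit_det _).1 hunit), one_mulVec]
end

section
/- Let A ∈ ℝ^{n×n} be such that every complex eigenvalue of A has modulus exactly 1. Let X and U be independent ℝⁿ-valued random vectors with E‖X‖² < ∞ and E‖U‖² < ∞, satisfying the fixed-point-in-law equation X =_d AX + U. Then U is almost surely equal to a constant vector, and this constant lies in the range of the matrix I − A. -/
open MeasureTheory ProbabilityTheory Matrix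

open Module in
/-- If `s` decreases along the dynamics of `B` exactly by the nonnegative quadratic form `q`, and all
eigenvalues of `B` have modulus one, then `q` vanishes. -/
theorem quadratic_eq_zero_of_dissipation {V : Type*} [AddCommGroup V] [Module ℂ V]
    [FiniteDimensional ℂ V] (B : End ℂ V) (hB : ∀ l, B.HasEigenvalue l → ‖l‖ = 1)
    (s q : V → ℝ) (hs : ∀ v, 0 ≤ s v) (hq : ∀ v, 0 ≤ q v)
    (hsmul : ∀ (c : ℂ) v, q (c • v) = ‖c‖ ^ 2 * q v)
    (hadd : ∀ v k, q k = 0 → q (v + k) = q v)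
    (hsq : ∀ v, s v = s (B v) + q v) (v : V) : q v = 0 := by
  let K : Submodule ℂ V :=
    { carrier := {v | ∀ j : ℕ, q ((B ^ j) v) = 0}
      zero_mem' := fun j => by simpa using hsmul 0 0
      add_mem' := fun {a b} ha hb j => by rw [map_add, hadd _ _ (hb j), ha j]
      smul_mem' := fun c a ha j => by rw [map_smul, hsmul, ha j, mul_zero] }
  have hBK : ∀ k ∈ K, B k ∈ K := fun k hk j => by
    have := hk (j + 1)
    rwa [pow_succ] at this
  have hstep : ∀ l : ℂ, ‖l‖ = 1 → ∀ w, (B - algebraMap ℂ (End ℂ V) l) w ∈ K → w ∈ K := by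
    intro l hl w hw
    have hpow : ∀ j : ℕ, ∃ k ∈ K, (B ^ j) w = l ^ j • w + k := by
      intro j
      induction j with
      | zero => exact ⟨0, K.zero_mem, by simp⟩
      | succ j ih =>
        obtain ⟨k, hk, h⟩ := ih
        refine ⟨l ^ j • (B - algebraMap ℂ (End ℂ V) l) w + B k,
          K.add_mem (K.smul_mem _ hw) (hBK k hk), ?_⟩
        rw [pow_succ', Module.End.mul_apply, h, map_add, map_smul, LinearMap.sub_apply,
          Module.algebraMap_end_apply, smul_sub, smul_smul, pow_succ]
        abel
    have hconst : ∀ j : ℕ, q ((B ^ j) w) = q w := by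
      intro j
      obtain ⟨k, hk, h⟩ := hpow j
      rw [h, hadd _ _ (by simpa using hk 0), hsmul, norm_pow, hl]
      simp
    have hsum : ∀ N : ℕ, s w = s ((B ^ N) w) + N * q w := by
      intro N
      induction N with
      | zero => simp
      | succ N ih =>
        rw [ih, hsq ((B ^ N) w), hconst, pow_succ', Module.End.mul_apply]
        push_cast
        ring
    have hzero : q w = 0 := by
      by_contra hne
      have hpos : 0 < q w := lt_of_le_of_ne (hq w) (Ne.symm hne)
      obtain ⟨N, hN⟩ := exists_nat_gt (s w / q w)
      rw [div_lt_iff₀ hpos] at hN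
      linarith [hsum N, hs ((B ^ N) w)]
    exact fun j => (hconst j).trans hzero
  have hgen : ∀ l : ℂ, B.maxGenEigenspace l ≤ K := by
    intro l w hw
    obtain ⟨m, hm⟩ := (Module.End.mem_maxGenEigenspace B l w).1 hw
    by_cases hl : B.HasEigenvalue l
    · have hind : ∀ (m : ℕ) (w : V), ((B - l • (1 : End ℂ V)) ^ m) w = 0 → w ∈ K := by
        intro m
        induction m with
        | zero => intro w hw; simp only [pow_zero, Module.End.one_apply] at hw; simp [hw]
        | succ m ih =>
          intro w hw
          refine hstep l (hB l hl) w (ih _ ?_)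
          rw [Algebra.algebraMap_eq_smul_one, ← Module.End.mul_apply, ← pow_succ, hw]
      exact hind m w hm
    · have hker : LinearMap.ker (B - l • (1 : End ℂ V)) = ⊥ := by
        rwa [Module.End.hasEigenvalue_iff, not_not, Module.End.eigenspace_def] at hl
      have hinj := LinearMap.ker_eq_bot.1 hker
      have : w = 0 := by
        apply (hinj.iterate m)
        rw [← Module.End.coe_pow, hm, map_zero]
      simp [this]
  have htop : v ∈ K := (iSup_le hgen) (by
    rw [Module.End.iSup_maxGenEigenspace_eq_top]; trivial)
  simpa using htop 0

section Moments

variable {n : ℕ} {Ω : Type*} [MeasurableSpace Ω] {μ : Measure Ω}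

theorem memLp_dotProduct_s11 {Y : Ω → Fin n → ℝ} {p : ENNReal} (hY : MemLp Y p μ) (w : Fin n → ℝ) :
    MemLp (fun ω => w ⬝ᵥ Y ω) p μ :=
  memLp_finsetSum _ fun i _ => (hY.eval i).const_mul (w i)

theorem integral_const_dotProduct {Y : Ω → Fin n → ℝ} (hY : Integrable Y μ) (w : Fin n → ℝ) :
    ∫ ω, w ⬝ᵥ Y ω ∂μ = w ⬝ᵥ ∫ ω, Y ω ∂μ := by
  simp only [dotProduct]
  rw [integral_finsetSum _ fun i _ => (hY.eval i).const_mul (w i)]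
  simp only [integral_const_mul, eval_integral fun i => hY.eval i]

/-- The value of a complex linear functional at the centred random vector. -/
noncomputable def centeredPairing (μ : Measure Ω) (Y : Ω → Fin n → ℝ) (v : Fin n → ℂ) (ω : Ω) : ℂ :=
  v ⬝ᵥ fun i => ((Y ω i - (∫ ω, Y ω ∂μ) i : ℝ) : ℂ)

theorem centeredPairing_smul (Y : Ω → Fin n → ℝ) (c : ℂ) (v : Fin n → ℂ) (ω : Ω) :
    centeredPairing μ Y (c • v) ω = c * centeredPairing μ Y v ω := by
  simp [centeredPairing]

theorem centeredPairing_add (Y : Ω → Fin n → ℝ) (v k : Fin n → ℂ) (ω : Ω) :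
    centeredPairing μ Y (v + k) ω = centeredPairing μ Y v ω + centeredPairing μ Y k ω := by
  simp [centeredPairing]

theorem norm_sq_centeredPairing [IsFiniteMeasure μ] {Y : Ω → Fin n → ℝ} (hY : MemLp Y 2 μ)
    (v : Fin n → ℂ) (ω : Ω) :
    ‖centeredPairing μ Y v ω‖ ^ 2 =
      ((fun i => (v i).re) ⬝ᵥ Y ω - ∫ ω, (fun i => (v i).re) ⬝ᵥ Y ω ∂μ) ^ 2 +
      ((fun i => (v i).im) ⬝ᵥ Y ω - ∫ ω, (fun i => (v i).im) ⬝ᵥ Y ω ∂μ) ^ 2 := by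
  have hint : Integrable Y μ := hY.integrable one_le_two
  rw [integral_const_dotProduct hint, integral_const_dotProduct hint, ← dotProduct_sub,
    ← dotProduct_sub, Complex.sq_norm, Complex.normSq_apply, ← sq, ← sq]
  congr 2 <;> simp [centeredPairing, dotProduct]

theorem integrable_norm_sq_centeredPairing [IsFiniteMeasure μ] {Y : Ω → Fin n → ℝ}
    (hY : MemLp Y 2 μ) (v : Fin n → ℂ) :
    Integrable (fun ω => ‖centeredPairing μ Y v ω‖ ^ 2) μ := by
  simp only [norm_sq_centeredPairing hY]
  exact ((memLp_dotProduct_s11 hY _).sub (memLp_const _)).integrable_sq.add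
    ((memLp_dotProduct_s11 hY _).sub (memLp_const _)).integrable_sq

theorem integral_norm_sq_centeredPairing [IsFiniteMeasure μ] {Y : Ω → Fin n → ℝ}
    (hY : MemLp Y 2 μ) (v : Fin n → ℂ) :
    ∫ ω, ‖centeredPairing μ Y v ω‖ ^ 2 ∂μ =
      Var[fun ω => (fun i => (v i).re) ⬝ᵥ Y ω; μ] +
      Var[fun ω => (fun i => (v i).im) ⬝ᵥ Y ω; μ] := by
  simp only [norm_sq_centeredPairing hY]
  rw [variance_eq_integral (memLp_dotProduct_s11 hY _).aemeasurable,
    variance_eq_integral (memLp_dotProduct_s11 hY _).aemeasurable]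
  exact integral_add ((memLp_dotProduct_s11 hY _).sub (memLp_const _)).integrable_sq
    ((memLp_dotProduct_s11 hY _).sub (memLp_const _)).integrable_sq

theorem centeredPairing_ae_eq_zero [IsFiniteMeasure μ] {Y : Ω → Fin n → ℝ}
    (hY : MemLp Y 2 μ) {v : Fin n → ℂ} (h : ∫ ω, ‖centeredPairing μ Y v ω‖ ^ 2 ∂μ = 0) :
    ∀ᵐ ω ∂μ, centeredPairing μ Y v ω = 0 := by
  rw [integral_eq_zero_iff_of_nonneg (fun _ => by positivity)
    (integrable_norm_sq_centeredPairing hY v)] at h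
  filter_upwards [h] with ω hω
  simpa using hω

end Moments

/-- Let `A ∈ ℝ^{n×n}` have all complex eigenvalues of modulus exactly
`1`.  If `X` and `U` are independent `ℝⁿ`-valued random vectors with finite second moments
satisfying `X =_d AX + U`, then `U` is a.s. equal to a constant vector lying in the range
of `I − A`. -/
theorem fixed_point_rotational_block {n : ℕ} (A : Matrix (Fin n) (Fin n) ℝ)
    (hspec : ∀ l ∈ spectrum ℂ (A.map (Complex.ofReal)), ‖l‖ = 1)
    {Ω : Type*} [MeasurableSpace Ω] (μ : Measure Ω) [IsProbabilityMeasure μ]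
    (X U : Ω → Fin n → ℝ) (hX : Measurable X) (hU : Measurable U)
    (hX2 : Integrable (fun ω => ‖X ω‖ ^ 2) μ) (hU2 : Integrable (fun ω => ‖U ω‖ ^ 2) μ)
    (hindep : IndepFun X U μ)
    (hfix : μ.map X = μ.map (fun ω => A.mulVec (X ω) + U ω)) :
    ∃ u₀ : Fin n → ℝ, (∀ᵐ ω ∂μ, U ω = u₀) ∧ ∃ x : Fin n → ℝ, (1 - A).mulVec x = u₀ := by
  have hXL : MemLp X 2 μ := (memLp_two_iff_integrable_sq_norm hX.aestronglyMeasurable).2 hX2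
  have hUL : MemLp U 2 μ := (memLp_two_iff_integrable_sq_norm hU.aestronglyMeasurable).2 hU2
  have hXi : Integrable X μ := hXL.integrable one_le_two
  have hUi : Integrable U μ := hUL.integrable one_le_two
  have hmeas : Measurable fun ω => A.mulVec (X ω) + U ω := by fun_prop
  have hid : IdentDistrib X (fun ω => A.mulVec (X ω) + U ω) μ μ :=
    ⟨hX.aemeasurable, hmeas.aemeasurable, hfix⟩
  have hdot : ∀ w : Fin n → ℝ, Measurable fun y : Fin n → ℝ => w ⬝ᵥ y := fun w => by
    unfold dotProduct; fun_prop
  have hexpand : ∀ w : Fin n → ℝ, (fun ω => w ⬝ᵥ (A.mulVec (X ω) + U ω)) =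
      fun ω => (w ᵥ* A) ⬝ᵥ X ω + w ⬝ᵥ U ω := fun w => by
    ext ω; rw [dotProduct_add, dotProduct_mulVec]
  have hvar : ∀ w : Fin n → ℝ, Var[fun ω => w ⬝ᵥ X ω; μ] =
      Var[fun ω => (w ᵥ* A) ⬝ᵥ X ω; μ] + Var[fun ω => w ⬝ᵥ U ω; μ] := by
    intro w
    have h1 := (hid.comp (hdot w)).variance_eq
    simp only [Function.comp_def, hexpand w] at h1
    rw [h1]
    exact IndepFun.variance_add (memLp_dotProduct_s11 hXL _) (memLp_dotProduct_s11 hUL _)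
      (hindep.comp (hdot (w ᵥ* A)) (hdot w))
  have hmean : ∀ w : Fin n → ℝ, w ⬝ᵥ ∫ ω, X ω ∂μ =
      w ⬝ᵥ (A.mulVec (∫ ω, X ω ∂μ) + ∫ ω, U ω ∂μ) := by
    intro w
    have h1 := (hid.comp (hdot w)).integral_eq
    simp only [Function.comp_def] at h1
    rw [hexpand w, integral_add ((memLp_dotProduct_s11 hXL _).integrable one_le_two)
      ((memLp_dotProduct_s11 hUL _).integrable one_le_two), integral_const_dotProduct hXi,
      integral_const_dotProduct hXi, integral_const_dotProduct hUi] at h1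
    rw [h1, dotProduct_add, dotProduct_mulVec]
  have hmean' : ∫ ω, X ω ∂μ = A.mulVec (∫ ω, X ω ∂μ) + ∫ ω, U ω ∂μ :=
    dotProduct_eq _ _ fun w => by rw [dotProduct_comm, hmean, dotProduct_comm]
  let B : Module.End ℂ (Fin n → ℂ) := Matrix.toLin' (A.map Complex.ofReal)ᵀ
  have hBapp : ∀ v, B v = v ᵥ* A.map Complex.ofReal := fun v => by
    simp [B, Matrix.mulVec_transpose]
  have hB : ∀ l, B.HasEigenvalue l → ‖l‖ = 1 := by
    intro l hl
    apply hspec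
    rw [Module.End.hasEigenvalue_iff_mem_spectrum, Matrix.spectrum_toLin',
      Matrix.mem_spectrum_iff_isRoot_charpoly, Matrix.charpoly_transpose] at hl
    exact Matrix.mem_spectrum_iff_isRoot_charpoly.2 hl
  have hq : ∀ v : Fin n → ℂ, ∫ ω, ‖centeredPairing μ U v ω‖ ^ 2 ∂μ = 0 := by
    refine quadratic_eq_zero_of_dissipation B hB
      (fun v => ∫ ω, ‖centeredPairing μ X v ω‖ ^ 2 ∂μ) _
      (fun v => by positivity) (fun v => by positivity) ?_ ?_ ?_
    · intro c v
      simp only [centeredPairing_smul, norm_mul, mul_pow, integral_const_mul]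
    · intro v k hk
      refine integral_congr_ae ?_
      filter_upwards [centeredPairing_ae_eq_zero hUL hk] with ω hω
      rw [centeredPairing_add, hω, add_zero]
    · intro v
      have hre : (fun i => (B v i).re) = (fun i => (v i).re) ᵥ* A := by
        ext i; simp [hBapp, vecMul, dotProduct]
      have him : (fun i => (B v i).im) = (fun i => (v i).im) ᵥ* A := by
        ext i; simp [hBapp, vecMul, dotProduct]
      simp only [integral_norm_sq_centeredPairing hXL, integral_norm_sq_centeredPairing hUL,
        hre, him]
      rw [hvar fun i => (v i).re, hvar fun i => (v i).im]
      ring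
  refine ⟨∫ ω, U ω ∂μ, ?_, ∫ ω, X ω ∂μ, ?_⟩
  · have hall : ∀ᵐ ω ∂μ, ∀ i, centeredPairing μ U (Pi.single i 1) ω = 0 :=
      ae_all_iff.2 fun i => centeredPairing_ae_eq_zero hUL (hq _)
    filter_upwards [hall] with ω hω
    ext i
    have h := hω i
    rw [centeredPairing, single_one_dotProduct, Complex.ofReal_eq_zero] at h
    exact sub_eq_zero.1 h
  · rw [sub_mulVec, one_mulVec]
    exact sub_eq_iff_eq_add'.2 hmean'
end

section
/- Let J ∈ ℂ^{n×n} be a Jordan block for an eigenvalue λ ∈ ℂ with |λ| = 1 (that is, J has λ on the diagonal, ones on the superdiagonal, and zeros elsewhere). Suppose P, Q ∈ ℂ^{n×n} are Hermitian positive semidefinite and satisfy the discrete Lyapunov (Stein) equation P = J P J* + Q. Then Q = 0, and every entry of P vanishes except possibly the (1,1) entry (i.e., P_{ij} = 0 for all (i,j) ≠ (1,1)). -/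
open Matrix
open scoped ComplexOrder

/-- The `n × n` Jordan block with eigenvalue `l` on the diagonal and ones on the
superdiagonal. -/
def jordanBlock (n : ℕ) (l : ℂ) : Matrix (Fin n) (Fin n) ℂ :=
  Matrix.of fun i j => if (j : ℕ) = (i : ℕ) then l else if (j : ℕ) = (i : ℕ) + 1 then 1 else 0

theorem Matrix.PosSemidef.apply_eq_zero_of_diag_eq_zero {ι : Type*} [Fintype ι]
    {A : Matrix ι ι ℂ} (hA : A.PosSemidef) {i : ι} (hi : A i i = 0) (j : ι) :
    A i j = 0 ∧ A j i = 0 := by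
  classical
  have h := (hA.dotProduct_mulVec_zero_iff (Pi.single i 1)).1 (by simp [hi])
  have hji : A j i = 0 := by simpa using congrFun h j
  refine ⟨?_, hji⟩
  rw [← hA.1.apply i j, hji, star_zero]

/-- The entry of a square matrix at a pair of natural numbers, extended by zero outside the
index range. -/
def zeroExtend {n : ℕ} (A : Matrix (Fin n) (Fin n) ℂ) (i j : ℕ) : ℂ :=
  if h : i < n ∧ j < n then A ⟨i, h.1⟩ ⟨j, h.2⟩ else 0

theorem zeroExtend_eq_zero_of_diag_eq_zero {n : ℕ} {A : Matrix (Fin n) (Fin n) ℂ}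
    (hA : A.PosSemidef) {i : ℕ} (hi : zeroExtend A i i = 0) (j : ℕ) :
    zeroExtend A i j = 0 ∧ zeroExtend A j i = 0 := by
  by_cases h : i < n ∧ j < n
  · have hi' : A ⟨i, h.1⟩ ⟨i, h.1⟩ = 0 := by simpa [zeroExtend, h.1] using hi
    simpa [zeroExtend, h.1, h.2] using hA.apply_eq_zero_of_diag_eq_zero hi' ⟨j, h.2⟩
  · simp only [zeroExtend]
    grind

theorem sum_jordanBlock_mul {n : ℕ} (l : ℂ) (i : Fin n) (f : Fin n → ℂ) :
    ∑ x, jordanBlock n l i x * f x =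
      l * f i + if h : (i : ℕ) + 1 < n then f ⟨i + 1, h⟩ else 0 := by
  have key : ∀ x : Fin n, jordanBlock n l i x * f x =
      (if x = i then l * f x else 0) + if (x : ℕ) = i + 1 then f x else 0 := by
    intro x
    simp only [jordanBlock, Matrix.of_apply, Fin.ext_iff]
    by_cases h : (x : ℕ) = i
    · simp [h]
    · simp [h]
  simp only [key, Finset.sum_add_distrib, Finset.sum_ite_eq', Finset.mem_univ, if_true]
  congr 1
  split_ifs with h
  · rw [Finset.sum_eq_single ⟨i + 1, h⟩] <;> simp +contextual [Fin.ext_iff]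
  · exact Finset.sum_eq_zero fun x _ => if_neg (by omega)

theorem jordanBlock_mul_mul_conjTranspose_apply {n : ℕ} (l : ℂ) (hl : ‖l‖ = 1)
    (P : Matrix (Fin n) (Fin n) ℂ) (i j : Fin n) :
    (jordanBlock n l * P * (jordanBlock n l)ᴴ) i j =
      P i j + l * zeroExtend P i (j + 1) + star l * zeroExtend P (i + 1) j +
        zeroExtend P (i + 1) (j + 1) := by
  have hJ (A : Matrix (Fin n) (Fin n) ℂ) (a b : Fin n) : (jordanBlock n l * A) a b =
      l * A a b + if h : (a : ℕ) + 1 < n then A ⟨a + 1, h⟩ b else 0 := by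
    rw [Matrix.mul_apply, sum_jordanBlock_mul l a fun x => A x b]
  have hJ' (A : Matrix (Fin n) (Fin n) ℂ) (a b : Fin n) : (A * (jordanBlock n l)ᴴ) a b =
      star l * A a b + if h : (b : ℕ) + 1 < n then A a ⟨b + 1, h⟩ else 0 := by
    rw [← Matrix.conjTranspose_conjTranspose A, ← Matrix.conjTranspose_mul,
      Matrix.conjTranspose_apply, hJ]
    split_ifs <;> simp
  have hll : star l * l = 1 := by
    simpa [hl] using Complex.conj_mul' l
  rw [hJ', hJ]
  simp only [hJ, zeroExtend, i.2, j.2, true_and, and_true]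
  split_ifs <;> first | linear_combination (P i j) * hll | grind

/-- Let `J` be a Jordan block for an eigenvalue `l` with `|l| = 1`.
If Hermitian positive semidefinite matrices `P, Q` satisfy the Stein equation
`P = J P J* + Q`, then `Q = 0` and every entry of `P` except possibly the `(1,1)` entry
vanishes. -/
theorem stein_jordan_unit_circle {n : ℕ} (l : ℂ) (hl : ‖l‖ = 1)
    (P Q : Matrix (Fin n) (Fin n) ℂ) (hP : P.PosSemidef) (hQ : Q.PosSemidef)
    (hstein : P = jordanBlock n l * P * (jordanBlock n l)ᴴ + Q) :
    Q = 0 ∧ ∀ i j : Fin n, ¬((i : ℕ) = 0 ∧ (j : ℕ) = 0) → P i j = 0 := by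
  have hl0 : star l ≠ 0 := by
    rw [star_ne_zero]
    exact norm_ne_zero_iff.1 (hl ▸ one_ne_zero)
  have hrec (i j : ℕ) (hi : i < n) (hj : j < n) : l * zeroExtend P i (j + 1) +
      star l * zeroExtend P (i + 1) j + zeroExtend P (i + 1) (j + 1) + zeroExtend Q i j = 0 := by
    have h := congrFun (congrFun hstein ⟨i, hi⟩) ⟨j, hj⟩
    rw [Matrix.add_apply, jordanBlock_mul_mul_conjTranspose_apply l hl] at h
    have hq : zeroExtend Q i j = Q ⟨i, hi⟩ ⟨j, hj⟩ := by simp [zeroExtend, hi, hj]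
    rw [hq]
    linear_combination -h
  have hdiag (k : ℕ) (hk : 0 < k) : zeroExtend P k k = 0 := by
    obtain ⟨d, hd⟩ : ∃ d, n ≤ k + d := ⟨n, Nat.le_add_left n k⟩
    induction d generalizing k with
    | zero => simp [zeroExtend, show ¬k < n by omega]
    | succ d ih =>
      by_cases hkn : k < n
      · have hP' (j : ℕ) := zeroExtend_eq_zero_of_diag_eq_zero hP
          (ih (k + 1) k.succ_pos (by omega)) j
        have hQk : zeroExtend Q k k = 0 := by
          simpa [hP'] using hrec k k hkn hkn
        have hQ' := (zeroExtend_eq_zero_of_diag_eq_zero hQ hQk (k - 1)).2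
        have h := hrec (k - 1) k (by omega) hkn
        rw [Nat.sub_add_cancel hk] at h
        simpa [hP', hQ', star_ne_zero.1 hl0] using h
      · simp [zeroExtend, hkn]
  have hzero (i j : ℕ) (h : 0 < i ∨ 0 < j) : zeroExtend P i j = 0 := by
    rcases h with h | h
    · exact (zeroExtend_eq_zero_of_diag_eq_zero hP (hdiag i h) j).1
    · exact (zeroExtend_eq_zero_of_diag_eq_zero hP (hdiag j h) i).2
  constructor
  · ext i j
    have h := hrec i j i.2 j.2
    simp only [hzero _ _ (Or.inl (Nat.succ_pos _)), hzero _ _ (Or.inr (Nat.succ_pos _)), mul_zero,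
      zero_add] at h
    simpa [zeroExtend] using h
  · intro i j hij
    simpa [zeroExtend] using hzero i j (by omega)
end

section
/- Let J ∈ ℂ^{n×n} be a Jordan block for an eigenvalue λ ∈ ℂ with |λ| > 1. Suppose P, Q ∈ ℂ^{n×n} are Hermitian positive semidefinite and satisfy the discrete Lyapunov (Stein) equation P = J P J* + Q. Then P = 0 and Q = 0. -/
open Matrix
open scoped ComplexOrder

namespace Matrix

/-- A positive semidefinite matrix with a vanishing diagonal entry vanishes on that column. -/
theorem PosSemidef.apply_eq_zero_of_diag_eq_zero_s13 {ι : Type*} [Fintype ι] {P : Matrix ι ι ℂ}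
    (hP : P.PosSemidef) {j : ι} (hj : P j j = 0) (i : ι) : P i j = 0 := by
  classical
  have h : P *ᵥ Pi.single j 1 = 0 := by
    rw [← hP.dotProduct_mulVec_zero_iff]
    simpa [← Pi.single_star] using hj
  simpa using congrFun h i

/-- If `J` is upper triangular with all diagonal entries of norm greater than one, then the only
positive semidefinite `P` such that `P - J * P * Jᴴ` is positive semidefinite is `0`. -/
theorem PosSemidef.eq_zero_of_stein_expanding {ι : Type*} [Fintype ι] [LinearOrder ι]
    {J P Q : Matrix ι ι ℂ} (hJ : J.BlockTriangular id) (hdiag : ∀ i, 1 < ‖J i i‖)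
    (hP : P.PosSemidef) (hQ : Q.PosSemidef) (h : P = J * P * Jᴴ + Q) : P = 0 := by
  suffices hcol : ∀ j, P j j = 0 by
    ext i j
    exact hP.apply_eq_zero_of_diag_eq_zero_s13 (hcol j) i
  intro j
  induction j using WellFoundedGT.induction with
  | ind j ih =>
    have hPcol (i k : ι) (hk : j < k) : P i k = 0 :=
      hP.apply_eq_zero_of_diag_eq_zero_s13 (ih k hk) i
    have hProw (i k : ι) (hk : j < k) : P k i = 0 := by
      rw [← hP.isHermitian.apply, hPcol i k hk, star_zero]
    have hJP : ∀ b, (J * P) j b = J j j * P j b := fun b ↦ by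
      rw [mul_apply]
      refine Fintype.sum_eq_single j fun a ha ↦ ?_
      rcases ha.lt_or_gt with ha | ha
      · rw [hJ ha, zero_mul]
      · rw [hProw b a ha, mul_zero]
    have hJPJ : (J * P * Jᴴ) j j = J j j * P j j * star (J j j) := by
      rw [mul_apply, ← hJP, ← conjTranspose_apply]
      refine Fintype.sum_eq_single j fun b hb ↦ ?_
      rcases hb.lt_or_gt with hb | hb
      · rw [conjTranspose_apply, hJ hb, star_zero, mul_zero]
      · rw [hJP, hPcol j b hb, mul_zero, zero_mul]
    have hjj : P j j = (‖J j j‖ ^ 2 : ℝ) * P j j + Q j j := by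
      have := congrFun₂ h j j
      rw [add_apply, hJPJ, mul_right_comm, Complex.star_def, Complex.mul_conj'] at this
      exact_mod_cast this
    have hre := congrArg Complex.re hjj
    rw [Complex.add_re, Complex.re_ofReal_mul] at hre
    obtain ⟨hP0, hPim⟩ := Complex.nonneg_iff.mp (hP.diag_nonneg (i := j))
    obtain ⟨hQ0, -⟩ := Complex.nonneg_iff.mp (hQ.diag_nonneg (i := j))
    have hsq : 1 < ‖J j j‖ ^ 2 := one_lt_pow₀ (hdiag j) two_ne_zero
    exact Complex.ext (by rw [Complex.zero_re]; nlinarith) hPim.symm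

end Matrix

theorem jordanBlock_blockTriangular (n : ℕ) (l : ℂ) : (jordanBlock n l).BlockTriangular id := by
  intro i j hij
  have hij : (j : ℕ) < i := hij
  simp only [jordanBlock, of_apply]
  rw [if_neg (by lia), if_neg (by lia)]

theorem jordanBlock_diag (n : ℕ) (l : ℂ) (i : Fin n) : jordanBlock n l i i = l := by
  simp [jordanBlock]

/-- Let `J` be a Jordan block for an eigenvalue `l` with `|l| > 1`.
If Hermitian positive semidefinite matrices `P, Q` satisfy the Stein equation
`P = J P J* + Q`, then `P = 0` and `Q = 0`. -/
theorem stein_jordan_expanding {n : ℕ} (l : ℂ) (hl : 1 < ‖l‖)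
    (P Q : Matrix (Fin n) (Fin n) ℂ) (hP : P.PosSemidef) (hQ : Q.PosSemidef)
    (hstein : P = jordanBlock n l * P * (jordanBlock n l)ᴴ + Q) :
    P = 0 ∧ Q = 0 := by
  have hP0 : P = 0 := hP.eq_zero_of_stein_expanding (jordanBlock_blockTriangular n l)
    (fun i ↦ by rwa [jordanBlock_diag]) hQ hstein
  refine ⟨hP0, ?_⟩
  simpa [hP0] using hstein.symm
end

section
/- Let X be an ℝ²-valued random vector and θ ∈ [0, 2π) be such that X has the same distribution as R_θ X, where R_θ is the counterclockwise planar rotation by angle θ. Then either θ/(2π) is rational, or X is invariant in distribution under all rotations, i.e., X has the same distribution as R_φ X for every φ ∈ ℝ. -/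
open MeasureTheory

theorem rot2_zero : rot2 0 = id := by
  funext p; simp [rot2]

theorem rot2_two_pi : rot2 (2 * Real.pi) = id := by
  funext p; simp [rot2]

theorem rot2_add (a b : ℝ) : rot2 (a + b) = rot2 a ∘ rot2 b := by
  funext p
  simp only [rot2, Function.comp, Real.cos_add, Real.sin_add, Prod.mk.injEq]
  constructor <;> ring

theorem continuous_uncurry_rot2 : Continuous fun q : ℝ × (ℝ × ℝ) => rot2 q.1 q.2 := by
  unfold rot2
  fun_prop

theorem continuous_rot2 (φ : ℝ) : Continuous (rot2 φ) := by
  unfold rot2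
  fun_prop

theorem measurable_rot2 (φ : ℝ) : Measurable (rot2 φ) :=
  (continuous_rot2 φ).measurable

/-- The angles of the rotations preserving a measure on the plane. -/
def rotationStabilizer (ν : Measure (ℝ × ℝ)) : AddSubgroup ℝ where
  carrier := {φ | ν.map (rot2 φ) = ν}
  zero_mem' := by simp [rot2_zero]
  add_mem' {a b} ha hb := by
    simp only [Set.mem_ofPred_eq] at ha hb ⊢
    rw [rot2_add, ← Measure.map_map (measurable_rot2 a) (measurable_rot2 b), hb, ha]
  neg_mem' {a} ha := by
    simp only [Set.mem_ofPred_eq] at ha ⊢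
    nth_rewrite 1 [← ha]
    rw [Measure.map_map (measurable_rot2 _) (measurable_rot2 _), ← rot2_add,
      neg_add_cancel, rot2_zero, Measure.map_id]

theorem mem_rotationStabilizer {ν : Measure (ℝ × ℝ)} {φ : ℝ} :
    φ ∈ rotationStabilizer ν ↔ ν.map (rot2 φ) = ν :=
  Iff.rfl

theorem isClosed_rotationStabilizer (ν : Measure (ℝ × ℝ)) [IsFiniteMeasure ν] :
    IsClosed (rotationStabilizer ν : Set ℝ) := by
  have h : (rotationStabilizer ν : Set ℝ) =
      ⋂ f : BoundedContinuousFunction (ℝ × ℝ) ℝ, {φ | ∫ x, f (rot2 φ x) ∂ν = ∫ x, f x ∂ν} := by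
    ext φ
    have hmap (f : BoundedContinuousFunction (ℝ × ℝ) ℝ) :
        ∫ x, f x ∂(ν.map (rot2 φ)) = ∫ x, f (rot2 φ x) ∂ν :=
      integral_map (measurable_rot2 φ).aemeasurable f.continuous.aestronglyMeasurable
    simp only [SetLike.mem_coe, mem_rotationStabilizer, Set.mem_iInter, Set.mem_ofPred_eq, ← hmap]
    exact ⟨fun h f => by rw [h], ext_of_forall_integral_eq_of_IsFiniteMeasure⟩
  rw [h]
  refine isClosed_iInter fun f => isClosed_eq ?_ continuous_const
  refine continuous_of_dominated (bound := fun _ => ‖f‖) (fun φ => ?_) (fun φ => ?_)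
    (integrable_const _) ?_
  · exact (f.continuous.comp (continuous_rot2 φ)).aestronglyMeasurable
  · exact .of_forall fun x => f.norm_coe_le_norm _
  · exact .of_forall fun x =>
      f.continuous.comp (continuous_uncurry_rot2.comp (continuous_id.prodMk continuous_const))

theorem rotationStabilizer_eq_top (ν : Measure (ℝ × ℝ)) [IsFiniteMeasure ν] {θ : ℝ}
    (hirr : Irrational (θ / (2 * Real.pi))) (hθ : θ ∈ rotationStabilizer ν) :
    rotationStabilizer ν = ⊤ := by
  have hsub : AddSubgroup.closure {θ, 2 * Real.pi} ≤ rotationStabilizer ν := by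
    rw [AddSubgroup.closure_le, Set.pair_subset_iff]
    exact ⟨hθ, mem_rotationStabilizer.2 (by rw [rot2_two_pi, Measure.map_id])⟩
  have hdense := (dense_addSubgroupClosure_pair_iff.2 hirr).mono hsub
  exact SetLike.coe_injective ((isClosed_rotationStabilizer ν).closure_eq ▸ hdense.closure_eq)


/-- If an `ℝ²`-valued random vector `X` has the same distribution as
`R_θ X` for some `θ ∈ [0, 2π)`, then either `θ/(2π)` is rational, or `X` is invariant in
distribution under all rotations. -/
theorem rotation_invariance_dichotomy {Ω : Type*} [MeasurableSpace Ω] (μ : Measure Ω)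
    [IsProbabilityMeasure μ] (X : Ω → ℝ × ℝ) (hX : Measurable X)
    (θ : ℝ) (hθ : θ ∈ Set.Ico 0 (2 * Real.pi))
    (hsym : μ.map X = μ.map (fun ω => rot2 θ (X ω))) :
    (∃ q : ℚ, θ / (2 * Real.pi) = (q : ℝ)) ∨
      ∀ φ : ℝ, μ.map X = μ.map (fun ω => rot2 φ (X ω)) := by
  have hmap (φ : ℝ) : (μ.map X).map (rot2 φ) = μ.map (fun ω => rot2 φ (X ω)) :=
    Measure.map_map (measurable_rot2 φ) hX
  refine or_iff_not_imp_left.2 fun hq φ => ?_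
  have hirr : Irrational (θ / (2 * Real.pi)) := fun ⟨q, h⟩ => hq ⟨q, h.symm⟩
  have htop := rotationStabilizer_eq_top (μ.map X) hirr
    (mem_rotationStabilizer.2 ((hmap θ).trans hsym.symm))
  have hφ : φ ∈ rotationStabilizer (μ.map X) := htop ▸ AddSubgroup.mem_top φ
  rw [← hmap, mem_rotationStabilizer.1 hφ]
end
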